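/- If G is a (1,3)-critical graph, then 14|V(G)| - 9|E(G)| <= -6. -/

import Mathlib

/-- G is (1,3)-colorable. -/
def Colorable13 {V : Type*} (G : SimpleGraph V) : Prop :=
  ∃ f : V → Bool,
    (∀ v, f v = true → (G.neighborSet v ∩ {u | f u = true}).ncard ≤ 1) ∧
    (∀ v, f v = false → (G.neighborSet v ∩ {u | f u = false}).ncard ≤ 3)

/-- G is (1,3)-critical: not (1,3)-colorable, but every proper subgraph is. -/
def Critical13 {V : Type*} (G : SimpleGraph V) : Prop :=
  ¬ Colorable13 G ∧ ∀ H : G.Subgraph, H ≠ ⊤ → Colorable13 H.coe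

set_option linter.unusedSectionVars false

namespace DefectiveColoring

/-- Potential of a vertex which tolerates `a` neighbours in color `true` and `b` neighbours in
color `false`; a negative capacity forbids the color. -/
def pot (a b : ℤ) : ℤ := if a < 0 ∧ b < 0 then -6 else 1 + 4 * max a (-1) + 3 * max b 0

variable {V : Type*} [DecidableEq V]

/-- Symmetric edge data: `D` counts ordinary edges, and `s` counts soft edges, i.e. paths of
length two whose middle vertex has no other neighbour. -/
structure EdgeData (D s : V → V → ℤ) : Prop where
  D_symm : ∀ u v, D u v = D v u
  s_symm : ∀ u v, s u v = s v u
  D_self : ∀ v, D v v = 0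
  s_self : ∀ v, s v v = 0
  D_nonneg : ∀ u v, 0 ≤ D u v
  D_le : ∀ u v, D u v ≤ 1
  s_nonneg : ∀ u v, 0 ≤ s u v

/-- Twice the potential of a vertex set. -/
def rho (D s : V → V → ℤ) (U : Finset V) (a b : V → ℤ) : ℤ :=
  2 * ∑ v ∈ U, pot (a v) (b v) - ∑ u ∈ U, ∑ v ∈ U, (9 * D u v + 4 * s u v)

/-- `f` colors `U`, and each soft edge with differently colored ends loads one of its ends
(`l u v` is the load that the soft edges between `u` and `v` put on `u`). -/
def IsCol (D s : V → V → ℤ) (U : Finset V) (a b : V → ℤ) (f : V → Bool) (l : V → V → ℤ) : Prop :=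
  (∀ u v, 0 ≤ l u v) ∧ (∀ u ∈ U, ∀ v ∈ U, f u ≠ f v → s u v ≤ l u v + l v u) ∧
    ∀ v ∈ U, ∑ w ∈ U, (if f w = f v then D v w else l v w) ≤ if f v then a v else b v

def Col (D s : V → V → ℤ) (U : Finset V) (a b : V → ℤ) : Prop :=
  ∃ f l, IsCol D s U a b f l

def Crit (D s : V → V → ℤ) (U : Finset V) (a b : V → ℤ) : Prop :=
  ¬ Col D s U a b ∧ ∀ T, T ⊂ U → Col D s T a b

variable {D s : V → V → ℤ} {U S T : Finset V} {a b : V → ℤ}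

theorem Crit.nonempty (h : Crit D s U a b) : U.Nonempty := by
  rw [Finset.nonempty_iff_ne_empty]
  rintro rfl
  exact h.1 ⟨fun _ => true, fun _ _ => 0, by simp [IsCol]⟩

theorem exists_crit (h : ¬ Col D s U a b) : ∃ T ⊆ U, Crit D s T a b := by
  classical
  induction U using Finset.strongInduction with
  | H U ih =>
    by_cases hU : ∀ T, T ⊂ U → Col D s T a b
    · exact ⟨U, subset_rfl, h, hU⟩
    · push Not at hU
      obtain ⟨T, hT, hc⟩ := hU
      obtain ⟨T', hT', h'⟩ := ih T hT hc
      exact ⟨T', hT'.trans hT.1, h'⟩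

theorem rho_union (hE : EdgeData D s) (h : Disjoint S T) :
    rho D s (S ∪ T) a b =
      rho D s S a b + rho D s T a b - 2 * ∑ v ∈ T, ∑ w ∈ S, (9 * D w v + 4 * s w v) := by
  unfold rho
  rw [Finset.sum_union h, Finset.sum_union h]
  simp_rw [Finset.sum_union h, Finset.sum_add_distrib (s := S), Finset.sum_add_distrib (s := T)]
  have h1 : ∀ x : V → V → ℤ, ∑ u ∈ S, ∑ v ∈ T, x u v = ∑ v ∈ T, ∑ u ∈ S, x u v :=
    fun x => Finset.sum_comm
  simp only [Finset.sum_add_distrib]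
  rw [h1 (fun u v => 9 * D u v), h1 (fun u v => 4 * s u v)]
  have h2 : ∀ u v, D u v = D v u := hE.D_symm
  have h3 : ∑ v ∈ T, ∑ u ∈ S, 9 * D v u = ∑ v ∈ T, ∑ u ∈ S, 9 * D u v :=
    Finset.sum_congr rfl fun v _ => Finset.sum_congr rfl fun u _ => by rw [hE.D_symm]
  have h4 : ∑ v ∈ T, ∑ u ∈ S, 4 * s v u = ∑ v ∈ T, ∑ u ∈ S, 4 * s u v :=
    Finset.sum_congr rfl fun v _ => Finset.sum_congr rfl fun u _ => by rw [hE.s_symm]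
  rw [h3, h4]
  ring

theorem rho_insert (hE : EdgeData D s) {x : V} (hx : x ∉ S) :
    rho D s (insert x S) a b =
      rho D s S a b + 2 * pot (a x) (b x) - 18 * ∑ w ∈ S, D x w - 8 * ∑ w ∈ S, s x w := by
  have h : Disjoint S {x} := by simpa using hx
  have := rho_union (a := a) (b := b) hE h
  rw [Finset.union_comm, ← Finset.insert_eq] at this
  rw [this]
  have h1 : rho D s {x} a b = 2 * pot (a x) (b x) := by simp [rho, hE.D_self, hE.s_self]
  rw [h1, Finset.sum_singleton, Finset.sum_add_distrib, ← Finset.mul_sum, ← Finset.mul_sum]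
  simp_rw [hE.D_symm _ x, hE.s_symm _ x]
  ring

/-- Capacities towards color `true` that remain outside `S` once `S` is colored by `f`. The
vertices of `S` tolerate the conflicts along the edges counted by `kD` and `kS`; the other
ordinary edges forbid the color of their end in `S`. -/
def redA (D s : V → V → ℤ) (S : Finset V) (f : V → Bool) (kD kS : V → V → ℤ) (a : V → ℤ)
    (v : V) : ℤ :=
  a v - ∑ w ∈ S, if f w then 5 * D w v - 4 * kD w v else s w v - kS w v

/-- The analogue of `redA` for the color `false`. -/
def redB (D s : V → V → ℤ) (S : Finset V) (f : V → Bool) (kD kS : V → V → ℤ) (b : V → ℤ)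
    (v : V) : ℤ :=
  b v - ∑ w ∈ S, if f w then s w v - kS w v else 5 * D w v - 4 * kD w v

/-- `kD` and `kS` count edges between `S` and `T` whose conflicts `S` can tolerate. -/
structure Allow (D s : V → V → ℤ) (S T : Finset V) (a b : V → ℤ) (f : V → Bool)
    (l kD kS : V → V → ℤ) : Prop where
  kD_nonneg : ∀ u v, 0 ≤ kD u v
  kS_nonneg : ∀ u v, 0 ≤ kS u v
  kD_le : ∀ u v, kD u v ≤ D u v
  kS_le : ∀ u v, kS u v ≤ s u v
  room : ∀ w ∈ S, (∑ u ∈ S, if f u = f w then D w u else l w u) + ∑ v ∈ T, (kD w v + kS w v) ≤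
    if f w then a w else b w

theorem col_union (hE : EdgeData D s) (ha : ∀ v, a v ≤ 1) (hb : ∀ v, b v ≤ 3)
    (hST : Disjoint S T) {f : V → Bool} {l kD kS : V → V → ℤ}
    (hf : IsCol D s S a b f l) (hk : Allow D s S T a b f l kD kS)
    (hT : Col D s T (redA D s S f kD kS a) (redB D s S f kD kS b)) : Col D s (S ∪ T) a b := by
  obtain ⟨g, m, hm0, hm1, hm2⟩ := hT
  obtain ⟨hl0, hl1, -⟩ := hf
  have hTS : ∀ v ∈ T, v ∉ S := fun v hv hv' => Finset.disjoint_left.1 hST hv' hv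
  have hload : ∀ v ∈ T, 0 ≤ ∑ w ∈ T, (if g w = g v then D v w else m v w) := by
    intro v hv
    apply Finset.sum_nonneg
    intro w hw
    split_ifs
    · exact hE.D_nonneg _ _
    · exact hm0 _ _
  have hban : ∀ w ∈ S, ∀ v ∈ T, g v = f w → D w v ≤ kD w v := by
    intro w hw v hv hgf
    by_contra! hlt
    have h0 := hk.kD_nonneg w v
    have h1 := hE.D_le w v
    have hnn : ∀ u ∈ S, 0 ≤ 5 * D u v - 4 * kD u v := fun u hu => by
      have := hk.kD_le u v
      have := hE.D_nonneg u v
      linarith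
    have hns : ∀ u ∈ S, 0 ≤ s u v - kS u v := fun u hu => by
      have := hk.kS_le u v
      linarith
    have hl := hload v hv
    have h2 := hm2 v hv
    cases hfw : f w
    · rw [hgf, hfw] at h2
      have h3 : 5 * D w v - 4 * kD w v ≤
          ∑ u ∈ S, if f u then s u v - kS u v else 5 * D u v - 4 * kD u v := by
        have := Finset.single_le_sum (f := fun u => if f u then s u v - kS u v else
          5 * D u v - 4 * kD u v) (fun u hu => by
            split_ifs; exacts [hns u hu, hnn u hu]) hw
        simpa [hfw] using this
      have h4 := hb v
      simp only [redB] at h2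
      rw [hgf, hfw] at hl
      simp at h2
      linarith
    · rw [hgf, hfw] at h2
      have h3 : 5 * D w v - 4 * kD w v ≤
          ∑ u ∈ S, if f u then 5 * D u v - 4 * kD u v else s u v - kS u v := by
        have := Finset.single_le_sum (f := fun u => if f u then 5 * D u v - 4 * kD u v else
          s u v - kS u v) (fun u hu => by
            split_ifs; exacts [hnn u hu, hns u hu]) hw
        simpa [hfw] using this
      have h4 := ha v
      simp only [redA] at h2
      rw [hgf, hfw] at hl
      simp at h2
      linarith
  refine ⟨fun v => if v ∈ S then f v else g v, fun u v =>
    if u ∈ S then (if v ∈ S then l u v else kS u v) else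
      if v ∈ S then max (s v u - kS v u) 0 else m u v, ?_, ?_, ?_⟩
  · intro u v
    dsimp only
    split_ifs
    exacts [hl0 _ _, hk.kS_nonneg _ _, le_max_right _ _, hm0 _ _]
  · intro u hu v hv huv
    rcases Finset.mem_union.1 hu with hu | hu <;> rcases Finset.mem_union.1 hv with hv | hv
    · simp only [hu, hv, if_true] at huv ⊢
      exact hl1 u hu v hv huv
    · have := hTS v hv
      simp only [hu, this, if_true, if_false] at huv ⊢
      have := le_max_left (s u v - kS u v) 0
      linarith
    · have := hTS u hu
      simp only [hv, this, if_true, if_false] at huv ⊢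
      have := le_max_left (s v u - kS v u) 0
      have := hE.s_symm u v
      linarith
    · have h1 := hTS u hu
      have h2 := hTS v hv
      simp only [h1, h2, if_false] at huv ⊢
      exact hm1 u hu v hv huv
  · intro v hv
    rw [Finset.sum_union hST]
    rcases Finset.mem_union.1 hv with hv | hv
    · simp only [hv, if_true]
      refine le_trans (add_le_add (le_of_eq (Finset.sum_congr rfl fun w hw => ?_))
        (Finset.sum_le_sum fun w hw => ?_)) (hk.room v hv)
      · simp only [hw, if_true]
      · simp only [hTS w hw, if_false]
        have h1 := hk.kD_nonneg v w
        have h2 := hk.kS_nonneg v w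
        split_ifs with h
        · have := hban v hv w hw h
          linarith
        · linarith
    · have hvS := hTS v hv
      simp only [hvS, if_false]
      have h2 := hm2 v hv
      have e1 : ∑ w ∈ T, (if (if w ∈ S then f w else g w) = g v then D v w else
          if w ∈ S then max (s w v - kS w v) 0 else m v w) =
          ∑ w ∈ T, (if g w = g v then D v w else m v w) :=
        Finset.sum_congr rfl fun w hw => by simp only [hTS w hw, if_false]
      rw [e1]
      have e2 : ∑ w ∈ S, (if (if w ∈ S then f w else g w) = g v then D v w else
          if w ∈ S then max (s w v - kS w v) 0 else m v w) ≤
          ∑ w ∈ S, (if f w = g v then 5 * D w v - 4 * kD w v else s w v - kS w v) := by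
        refine Finset.sum_le_sum fun w hw => ?_
        simp only [hw, if_true]
        have h3 := hk.kD_le w v
        have h4 := hk.kS_le w v
        have h5 := hE.D_symm w v
        split_ifs
        · linarith
        · exact max_le le_rfl (by linarith)
      refine le_trans (add_le_add e2 h2) ?_
      cases hg : g v
      · simp only [redB]
        have : ∀ w, (if f w = false then 5 * D w v - 4 * kD w v else s w v - kS w v) =
          if f w = true then s w v - kS w v else 5 * D w v - 4 * kD w v := by
          intro w; cases f w <;> simp
        simp [this]
      · simp [redA]

theorem Crit.eq_of_not_col (h : Crit D s U a b) (hS : S ⊆ U) (hc : ¬ Col D s S a b) : S = U := by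
  by_contra hne
  exact hc (h.2 S (hS.ssubset_of_ne hne))

theorem col_true (h : ∀ v ∈ T, ∑ w ∈ T, D v w ≤ a v) : Col D s T a b :=
  ⟨fun _ => true, fun _ _ => 0, by simpa [IsCol] using h⟩

theorem not_col_of_lt (hE : EdgeData D s) (hb : ∀ v ∈ T, b v < 0) {v : V} (hv : v ∈ T)
    (h : a v < ∑ w ∈ T, D v w) : ¬ Col D s T a b := by
  rintro ⟨f, l, hl, -, hf⟩
  have hft : ∀ v ∈ T, f v = true := by
    intro v hv
    by_contra hfv
    have h1 := hf v hv
    have h2 := hb v hv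
    have h3 : 0 ≤ ∑ w ∈ T, (if f w = f v then D v w else l v w) := by
      apply Finset.sum_nonneg
      intro w hw
      split_ifs
      exacts [hE.D_nonneg _ _, hl _ _]
    rw [if_neg hfv] at h1
    linarith
  have h1 := hf v hv
  rw [Finset.sum_congr rfl fun w hw => by rw [hft w hw, hft v hv, if_pos rfl], hft v hv] at h1
  simp at h1
  linarith

theorem Crit.eq_singleton (hE : EdgeData D s) (h : Crit D s U a b) {v : V} (hv : v ∈ U)
    (ha : a v < 0) (hb : b v < 0) : U = {v} := by
  refine (h.eq_of_not_col (Finset.singleton_subset_iff.2 hv) ?_).symm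
  refine not_col_of_lt hE (by simpa using hb) (Finset.mem_singleton_self v) ?_
  simpa [hE.D_self] using ha

theorem Crit.structure_of_neg (hE : EdgeData D s) (ha : ∀ v, a v ≤ 1) (h : Crit D s T a b)
    (hb : ∀ v ∈ T, b v < 0) :
    (∃ v, T = {v} ∧ a v < 0) ∨
    (∃ v u, v ≠ u ∧ T = {v, u} ∧ D v u = 1 ∧ a v = 0 ∧ 0 ≤ a u) ∨
    ∃ v u u', v ≠ u ∧ v ≠ u' ∧ u ≠ u' ∧ T = {v, u, u'} ∧ D v u = 1 ∧ D v u' = 1 ∧ a v = 1 ∧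
      0 ≤ a u ∧ 0 ≤ a u' := by
  by_cases hneg : ∃ v ∈ T, a v < 0
  · obtain ⟨v, hv, hav⟩ := hneg
    exact Or.inl ⟨v, h.eq_singleton hE hv hav (hb v hv), hav⟩
  push Not at hneg
  right
  obtain ⟨v, hv, hlt⟩ : ∃ v ∈ T, a v < ∑ w ∈ T, D v w := by
    by_contra! hall
    exact h.1 (col_true hall)
  have h0 := hneg v hv
  have hD : ∀ w, D v w = 0 ∨ D v w = 1 := fun w => by
    have := hE.D_nonneg v w
    have := hE.D_le v w
    omega
  obtain ⟨u, hu, hvu⟩ : ∃ u ∈ T, D v u = 1 := by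
    by_contra! hall
    rw [Finset.sum_eq_zero fun w hw => (hD w).resolve_right (hall w hw)] at hlt
    omega
  have hne : v ≠ u := by
    rintro rfl
    rw [hE.D_self] at hvu
    omega
  have hsub : ({v, u} : Finset V) ⊆ T := by
    simp [Finset.insert_subset_iff, hv, hu]
  by_cases hav : a v = 0
  · left
    refine ⟨v, u, hne, (h.eq_of_not_col hsub ?_).symm, hvu, hav, hneg u hu⟩
    refine not_col_of_lt hE (fun w hw => hb w (hsub hw)) (Finset.mem_insert_self v _) ?_
    rw [Finset.sum_pair hne, hE.D_self, hvu, hav]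
    norm_num
  · right
    have hav1 : a v = 1 := by
      have := ha v
      omega
    obtain ⟨u', hu', huu, hvu'⟩ : ∃ u' ∈ T, u ≠ u' ∧ D v u' = 1 := by
      by_contra! hall
      rw [Finset.sum_eq_single u (fun w hw hwu => (hD w).resolve_right (hall w hw hwu.symm))
        (fun h => absurd hu h), hvu] at hlt
      omega
    have hne' : v ≠ u' := by
      rintro rfl
      rw [hE.D_self] at hvu'
      omega
    have hsub : ({v, u, u'} : Finset V) ⊆ T := by
      simp [Finset.insert_subset_iff, hv, hu, hu']
    refine ⟨v, u, u', hne, hne', huu, (h.eq_of_not_col hsub ?_).symm, hvu, hvu', hav1,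
      hneg u hu, hneg u' hu'⟩
    refine not_col_of_lt hE (fun w hw => hb w (hsub hw)) (Finset.mem_insert_self v _) ?_
    rw [Finset.sum_insert (by simp [hne, hne']), Finset.sum_pair huu, hE.D_self, hvu, hvu', hav1]
    norm_num

/-- The conclusion of the main induction. -/
def Bound (D s : V → V → ℤ) (U : Finset V) (a b : V → ℤ) : Prop :=
  rho D s U a b ≤ -6 ∧ ((∃ v ∈ U, 0 ≤ b v ∨ a v < 0) → rho D s U a b ≤ -12)

theorem rho_singleton (hE : EdgeData D s) (v : V) : rho D s {v} a b = 2 * pot (a v) (b v) := by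
  simp [rho, hE.D_self, hE.s_self]

theorem Crit.bound_of_neg (hE : EdgeData D s) (ha : ∀ v, a v ≤ 1) (h : Crit D s T a b)
    (hb : ∀ v ∈ T, b v < 0) : Bound D s T a b := by
  have hs := hE.s_nonneg
  rcases h.structure_of_neg hE ha hb with ⟨v, rfl, hv⟩ | ⟨v, u, hne, rfl, hD, hav, hau⟩ |
    ⟨v, u, u', h1, h2, h3, rfl, hD, hD', hav, hau, hau'⟩
  · have : pot (a v) (b v) = -6 := if_pos ⟨hv, hb v (by simp)⟩
    constructor <;> rw [rho_singleton hE, this] <;> norm_num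
  · have hb1 := hb v (by simp)
    have hb2 := hb u (by simp)
    have := hs v u
    have := ha u
    refine ⟨?_, ?_⟩
    · rw [rho_insert hE (by simpa using hne), rho_singleton hE]
      simp only [Finset.sum_singleton, hD, pot]
      split_ifs <;> omega
    · simp only [Finset.mem_insert, Finset.mem_singleton]
      rintro ⟨w, rfl | rfl, hw⟩ <;> omega
  · have hb1 := hb v (by simp)
    have hb2 := hb u (by simp)
    have hb3 := hb u' (by simp)
    have := hs v u
    have := hs v u'
    have := hs u u'
    have := hE.D_nonneg u u'
    have := ha u
    have := ha u'
    refine ⟨?_, ?_⟩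
    · rw [rho_insert hE (by simp [h1, h2]), rho_insert hE (by simpa using h3), rho_singleton hE,
        Finset.sum_pair h3, Finset.sum_pair h3]
      simp only [Finset.sum_singleton, hD, hD', pot]
      split_ifs <;> omega
    · simp only [Finset.mem_insert, Finset.mem_singleton]
      rintro ⟨w, rfl | rfl | rfl, hw⟩ <;> omega

/-- The surplus at `v` when `S` is removed and the capacities are reduced to `a'` and `b'`. -/
def exc (D s : V → V → ℤ) (S : Finset V) (a b a' b' : V → ℤ) (v : V) : ℤ :=
  9 * ∑ w ∈ S, D w v + 4 * ∑ w ∈ S, s w v - pot (a v) (b v) + pot (a' v) (b' v)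

theorem rho_union_exc (hE : EdgeData D s) (h : Disjoint S T) (a' b' : V → ℤ) :
    rho D s (S ∪ T) a b =
      rho D s S a b + rho D s T a' b' - 2 * ∑ v ∈ T, exc D s S a b a' b' v := by
  rw [rho_union hE h]
  simp only [rho, exc, Finset.sum_add_distrib, Finset.sum_sub_distrib, ← Finset.mul_sum]
  ring

/-- The guaranteed surplus contributed by the edges between `w` and `v`. -/
def gn (D s : V → V → ℤ) (f : V → Bool) (kD kS : V → V → ℤ) (w v : V) : ℤ :=
  5 * kD w v + 4 * kS w v + if f w then (D w v - kD w v) + (s w v - kS w v) else 0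

theorem Allow.atoms {f : V → Bool} {l kD kS : V → V → ℤ} (hk : Allow D s S T a b f l kD kS)
    (v : V) :
    ∃ N1 N2 H1 H2 Q1 Q2 Z : ℤ, 0 ≤ N1 ∧ 0 ≤ N2 ∧ 0 ≤ H1 ∧ 0 ≤ H2 ∧ 0 ≤ Q1 ∧ 0 ≤ Q2 ∧ 0 ≤ Z ∧
      redA D s S f kD kS a v = a v - (5 * N1 + H1 + Q2) ∧
      redB D s S f kD kS b v = b v - (5 * N2 + H2 + Q1) ∧
      ∑ w ∈ S, D w v = N1 + N2 + H1 + H2 ∧ ∑ w ∈ S, s w v = Q1 + Q2 + Z ∧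
      ∑ w ∈ S, gn D s f kD kS w v = N1 + Q1 + 5 * (H1 + H2) + 4 * Z ∧
      ∑ w ∈ S, kD w v = H1 + H2 ∧ ∑ w ∈ S, kS w v = Z := by
  refine ⟨∑ w ∈ S, if f w then D w v - kD w v else 0, ∑ w ∈ S, if f w then 0 else D w v - kD w v,
    ∑ w ∈ S, if f w then kD w v else 0, ∑ w ∈ S, if f w then 0 else kD w v,
    ∑ w ∈ S, if f w then s w v - kS w v else 0, ∑ w ∈ S, if f w then 0 else s w v - kS w v,
    ∑ w ∈ S, kS w v, ?_, ?_, ?_, ?_, ?_, ?_, ?_, ?_, ?_, ?_, ?_, ?_, ?_, rfl⟩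
  iterate 7
    · refine Finset.sum_nonneg fun w hw => ?_
      have := hk.kD_nonneg w v
      have := hk.kS_nonneg w v
      have := hk.kD_le w v
      have := hk.kS_le w v
      try split_ifs
      all_goals linarith
  iterate 2
    · simp only [redA, redB, sub_right_inj, Finset.mul_sum]
      rw [← Finset.sum_add_distrib, ← Finset.sum_add_distrib]
      refine Finset.sum_congr rfl fun w _ => ?_
      split_ifs <;> ring
  all_goals
    simp only [gn, ← Finset.sum_add_distrib, Finset.mul_sum]
    refine Finset.sum_congr rfl fun w _ => ?_
    split_ifs <;> ring

theorem Allow.gn_nonneg {f : V → Bool} {l kD kS : V → V → ℤ} (hk : Allow D s S T a b f l kD kS)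
    (w v : V) : 0 ≤ gn D s f kD kS w v := by
  have := hk.kD_nonneg w v
  have := hk.kS_nonneg w v
  have := hk.kD_le w v
  have := hk.kS_le w v
  unfold gn
  split_ifs <;> linarith

theorem pot_drop {α β N1 N2 H1 H2 Q1 Q2 Z : ℤ} (h8 : α ≤ 1) (h9 : β ≤ 3) (h1 : 0 ≤ N1)
    (h2 : 0 ≤ N2) (h3 : 0 ≤ H1) (h4 : 0 ≤ H2) (h5 : 0 ≤ Q1) (h6 : 0 ≤ Q2) (h7 : 0 ≤ Z) :
    (¬ (α - (5 * N1 + H1 + Q2) < 0 ∧ β - (5 * N2 + H2 + Q1) < 0) →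
      N1 + Q1 + 5 * (H1 + H2) + 4 * Z ≤ 9 * (N1 + N2 + H1 + H2) + 4 * (Q1 + Q2 + Z) - pot α β +
        pot (α - (5 * N1 + H1 + Q2)) (β - (5 * N2 + H2 + Q1))) ∧
    -3 ≤ 9 * (N1 + N2 + H1 + H2) + 4 * (Q1 + Q2 + Z) - pot α β +
        pot (α - (5 * N1 + H1 + Q2)) (β - (5 * N2 + H2 + Q1)) := by
  unfold pot
  simp only [max_def]
  obtain rfl | h10 := h1.eq_or_lt <;> obtain rfl | h11 := h2.eq_or_lt
  all_goals
    constructor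
    · intro h
      rw [if_neg h]
      split_ifs <;> omega
    · split_ifs <;> omega

theorem Allow.le_exc {f : V → Bool} {l kD kS : V → V → ℤ} (hk : Allow D s S T a b f l kD kS)
    (ha : ∀ v, a v ≤ 1) (hb : ∀ v, b v ≤ 3) (v : V) :
    (¬ (redA D s S f kD kS a v < 0 ∧ redB D s S f kD kS b v < 0) →
      ∑ w ∈ S, gn D s f kD kS w v ≤
        exc D s S a b (redA D s S f kD kS a) (redB D s S f kD kS b) v) ∧
    -3 ≤ exc D s S a b (redA D s S f kD kS a) (redB D s S f kD kS b) v := by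
  obtain ⟨N1, N2, H1, H2, Q1, Q2, Z, h1, h2, h3, h4, h5, h6, h7, hA, hB, hD, hs, hg, -, -⟩ :=
    hk.atoms v
  unfold exc
  rw [hA, hB, hD, hs, hg]
  exact pot_drop (ha v) (hb v) h1 h2 h3 h4 h5 h6 h7

theorem Allow.red_le {f : V → Bool} {l kD kS : V → V → ℤ} (hk : Allow D s S T a b f l kD kS)
    (v : V) : redA D s S f kD kS a v ≤ a v ∧ redB D s S f kD kS b v ≤ b v := by
  obtain ⟨N1, N2, H1, H2, Q1, Q2, Z, h1, h2, h3, h4, h5, h6, h7, hA, hB, hD, hs, hg, -, -⟩ :=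
    hk.atoms v
  omega

/-- The situation in the inductive step, assuming that the bound fails. -/
structure Ctx (D s : V → V → ℤ) (U : Finset V) (a b : V → ℤ) : Prop where
  edge : EdgeData D s
  a_le : ∀ v, a v ≤ 1
  b_le : ∀ v, b v ≤ 3
  crit : Crit D s U a b
  ih : ∀ (D' s' : V → V → ℤ) (T : Finset V) (a' b' : V → ℤ), T.card < U.card → EdgeData D' s' →
    (∀ v, a' v ≤ 1) → (∀ v, b' v ≤ 3) → Crit D' s' T a' b' → Bound D' s' T a' b'
  exists_b : ∃ v ∈ U, 0 ≤ b v
  lt : -12 < rho D s U a b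

theorem Ctx.not_both_neg (h : Ctx D s U a b) {v : V} (hv : v ∈ U) : ¬ (a v < 0 ∧ b v < 0) := by
  rintro ⟨h1, h2⟩
  obtain rfl := h.crit.eq_singleton h.edge hv h1 h2
  obtain ⟨w, hw, h3⟩ := h.exists_b
  rw [Finset.mem_singleton] at hw
  subst hw
  omega

theorem Ctx.ssubset_singleton (h : Ctx D s U a b) {v : V} (hv : v ∈ U) : {v} ⊂ U := by
  refine (Finset.singleton_subset_iff.2 hv).ssubset_of_ne ?_
  rintro rfl
  have h1 := h.not_both_neg hv
  refine h.crit.1 ⟨fun w => decide (0 ≤ a w), fun _ _ => 0, by simp, by simp, ?_⟩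
  simp only [Finset.mem_singleton, Finset.sum_singleton, forall_eq, if_true, h.edge.D_self]
  by_cases h2 : 0 ≤ a v <;> simp [h2]
  omega

/-- Removing a colored subset leaves a critical set for the reduced capacities. -/
theorem Ctx.exists_crit_red (h : Ctx D s U a b) (hS : S.Nonempty) (hSU : S ⊂ U) {f : V → Bool}
    {l kD kS : V → V → ℤ} (hf : IsCol D s S a b f l) (hk : Allow D s S (U \ S) a b f l kD kS) :
    ∃ T ⊆ U \ S, Crit D s T (redA D s S f kD kS a) (redB D s S f kD kS b) ∧
      Bound D s T (redA D s S f kD kS a) (redB D s S f kD kS b) := by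
  have hnc : ¬ Col D s (U \ S) (redA D s S f kD kS a) (redB D s S f kD kS b) := by
    intro hc
    have := col_union h.edge h.a_le h.b_le Finset.disjoint_sdiff hf hk hc
    rw [Finset.union_sdiff_of_subset hSU.1] at this
    exact h.crit.1 this
  obtain ⟨T, hT, hTc⟩ := exists_crit hnc
  refine ⟨T, hT, hTc, h.ih D s T _ _ ?_ h.edge (fun v => (hk.red_le v).1.trans (h.a_le v))
    (fun v => (hk.red_le v).2.trans (h.b_le v)) hTc⟩
  have h1 := Finset.card_le_card hT
  have h2 := Finset.card_sdiff_add_card_eq_card hSU.1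
  have h3 := hS.card_pos
  omega

/-- If the reduced critical set is not a single forbidden vertex, then each edge contributes its
guaranteed surplus. -/
theorem sum_gn_le_sum_exc (hE : EdgeData D s) (ha : ∀ v, a v ≤ 1) (hb : ∀ v, b v ≤ 3)
    {f : V → Bool} {l kD kS : V → V → ℤ} {W : Finset V} (hk : Allow D s S W a b f l kD kS)
    (hT : Crit D s T (redA D s S f kD kS a) (redB D s S f kD kS b))
    (hT1 : ∀ v, T = {v} → ¬ (redA D s S f kD kS a v < 0 ∧ redB D s S f kD kS b v < 0)) :
    ∑ v ∈ T, ∑ w ∈ S, gn D s f kD kS w v ≤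
      ∑ v ∈ T, exc D s S a b (redA D s S f kD kS a) (redB D s S f kD kS b) v :=
  Finset.sum_le_sum fun v hv => (hk.le_exc ha hb v).1 fun h =>
    hT1 v (hT.eq_singleton hE hv h.1 h.2) h

theorem Allow.sum_gn_nonneg {f : V → Bool} {l kD kS : V → V → ℤ} {W : Finset V}
    (hk : Allow D s S W a b f l kD kS) : 0 ≤ ∑ v ∈ T, ∑ w ∈ S, gn D s f kD kS w v :=
  Finset.sum_nonneg fun _ _ => Finset.sum_nonneg fun _ _ => hk.gn_nonneg _ _

theorem Allow.gn_le_sum {f : V → Bool} {l kD kS : V → V → ℤ} {W : Finset V}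
    (hk : Allow D s S W a b f l kD kS) {w v : V} (hw : w ∈ S) (hv : v ∈ T) :
    gn D s f kD kS w v ≤ ∑ v ∈ T, ∑ w ∈ S, gn D s f kD kS w v :=
  (Finset.single_le_sum (f := fun w => gn D s f kD kS w v) (fun _ _ => hk.gn_nonneg _ _) hw).trans
    (Finset.single_le_sum (f := fun v => ∑ w ∈ S, gn D s f kD kS w v)
      (fun _ _ => Finset.sum_nonneg fun _ _ => hk.gn_nonneg _ _) hv)

/-- `S` has the least potential among the nonempty proper subsets of `U`. -/
structure IsMin (D s : V → V → ℤ) (U : Finset V) (a b : V → ℤ) (S : Finset V) : Prop where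
  nonempty : S.Nonempty
  ssubset : S ⊂ U
  le : ∀ T : Finset V, T.Nonempty → T ⊂ U → rho D s S a b ≤ rho D s T a b

theorem Ctx.exists_isMin (h : Ctx D s U a b) : ∃ S, IsMin D s U a b S := by
  obtain ⟨v, hv, -⟩ := h.exists_b
  obtain ⟨S, hS, hmin⟩ := (U.powerset.filter fun S => S.Nonempty ∧ S ⊂ U).exists_min_image
    (fun S => rho D s S a b)
    ⟨{v}, by simp [h.ssubset_singleton hv, hv]⟩
  simp only [Finset.mem_filter, Finset.mem_powerset] at hS hmin
  exact ⟨S, hS.2.1, hS.2.2, fun T h1 h2 => hmin T ⟨h2.1, h1, h2⟩⟩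

/-- After a subset of least potential is removed, the whole rest is critical. -/
theorem Ctx.crit_sdiff (h : Ctx D s U a b) (hS : IsMin D s U a b S) {f : V → Bool}
    {l kD kS : V → V → ℤ} (hf : IsCol D s S a b f l) (hk : Allow D s S (U \ S) a b f l kD kS) :
    Crit D s (U \ S) (redA D s S f kD kS a) (redB D s S f kD kS b) ∧
      ((∃ v ∈ U \ S, 0 ≤ redB D s S f kD kS b v) →
        rho D s U a b + 12 + 2 * ∑ v ∈ U \ S, ∑ w ∈ S, gn D s f kD kS w v ≤ rho D s S a b) ∧
      rho D s U a b + 6 ≤ rho D s S a b := by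
  obtain ⟨T, hT, hTc, hTb⟩ := h.exists_crit_red hS.nonempty hS.ssubset hf hk
  have hdisj : Disjoint S T := Finset.disjoint_of_subset_right hT Finset.disjoint_sdiff
  have hr := rho_union_exc (a := a) (b := b) h.edge hdisj (redA D s S f kD kS a)
    (redB D s S f kD kS b)
  have hg := hk.sum_gn_nonneg (T := T)
  have key : rho D s (S ∪ T) a b + 6 ≤ rho D s S a b ∧ ((∃ v ∈ T, 0 ≤ redB D s S f kD kS b v) →
      rho D s (S ∪ T) a b + 12 + 2 * ∑ v ∈ T, ∑ w ∈ S, gn D s f kD kS w v ≤ rho D s S a b) := by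
    by_cases hT1 : ∃ v, T = {v} ∧ redA D s S f kD kS a v < 0 ∧ redB D s S f kD kS b v < 0
    · obtain ⟨v, rfl, h1, h2⟩ := hT1
      have h3 := hTb.2 ⟨v, by simp, Or.inr h1⟩
      have h4 := (hk.le_exc h.a_le h.b_le v).2
      rw [Finset.sum_singleton] at hr
      refine ⟨by omega, ?_⟩
      simp only [Finset.mem_singleton, exists_eq_left]
      omega
    · push Not at hT1
      have h1 := sum_gn_le_sum_exc h.edge h.a_le h.b_le hk hTc
        (fun v hv h' => absurd h'.2 (hT1 v hv h'.1).not_gt)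
      have h2 := hTb.1
      refine ⟨by omega, ?_⟩
      rintro ⟨v, hv, h3⟩
      have h4 := hTb.2 ⟨v, hv, Or.inl h3⟩
      omega
  have hTU : S ∪ T = U := by
    by_contra hne
    have hsub : S ∪ T ⊆ U := Finset.union_subset hS.ssubset.1 (hT.trans Finset.sdiff_subset)
    have := hS.le (S ∪ T) (hS.nonempty.mono Finset.subset_union_left) (hsub.ssubset_of_ne hne)
    omega
  have hTe : T = U \ S := by
    rw [← hTU, Finset.union_sdiff_cancel_left hdisj]
  rw [hTU] at key
  subst hTe
  exact ⟨hTc, key.2, key.1⟩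

theorem allow_zero (hE : EdgeData D s) {f : V → Bool} {l : V → V → ℤ} (W : Finset V)
    (hf : IsCol D s S a b f l) : Allow D s S W a b f l (fun _ _ => 0) fun _ _ => 0 where
  kD_nonneg _ _ := le_rfl
  kS_nonneg _ _ := le_rfl
  kD_le _ _ := hE.D_nonneg _ _
  kS_le _ _ := hE.s_nonneg _ _
  room w hw := by simpa using hf.2.2 w hw

theorem Ctx.weak_gap (h : Ctx D s U a b) (hS : S.Nonempty) (hSU : S ⊂ U) :
    rho D s U a b + 6 ≤ rho D s S a b := by
  obtain ⟨S', hS'⟩ := h.exists_isMin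
  obtain ⟨f, l, hf⟩ := h.crit.2 S' hS'.ssubset
  have := (h.crit_sdiff hS' hf (allow_zero h.edge _ hf)).2.2
  have := hS'.le S hS hSU
  omega

theorem Col.of_neg (hE : EdgeData D s) (hb : ∀ v ∈ T, b v < 0) (h : Col D s T a b)
    (s' : V → V → ℤ) (b' : V → ℤ) : Col D s' T a b' := by
  refine col_true fun v hv => ?_
  by_contra! hlt
  exact not_col_of_lt hE hb hv hlt h

theorem Ctx.exists_le_of_not_col (h : Ctx D s U a b) (hSU : S ⊂ U) {A B : V → ℤ}
    (hA : ∀ v, 0 ≤ A v) (hB : ∀ v, 0 ≤ B v) (hAb : ∀ v ∈ S, 0 ≤ b v ∨ A v = 0)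
    (hnc : ¬ Col D s S (fun v => a v - A v) fun v => b v - B v) :
    ∃ S' ⊆ S, S'.Nonempty ∧ rho D s S' a b ≤ -12 + 2 * ∑ v ∈ S', (4 * A v + 3 * B v) := by
  obtain ⟨S', hS', hc⟩ := exists_crit hnc
  refine ⟨S', hS', hc.nonempty, ?_⟩
  have hB' := h.ih D s S' _ _
    ((Finset.card_le_card hS').trans_lt (Finset.card_lt_card hSU)) h.edge
    (fun v => by have := h.a_le v; have := hA v; linarith)
    (fun v => by have := h.b_le v; have := hB v; linarith) hc
  have hr : rho D s S' a b = rho D s S' (fun v => a v - A v) (fun v => b v - B v) +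
      2 * ∑ v ∈ S', (pot (a v) (b v) - pot (a v - A v) (b v - B v)) := by
    simp only [rho, Finset.sum_sub_distrib]
    ring
  have hdrop : ∀ v ∈ S', pot (a v) (b v) - pot (a v - A v) (b v - B v) ≤ 4 * A v + 3 * B v := by
    intro v hv
    have h1 := h.not_both_neg (hSU.1 (hS' hv))
    have h2 := hAb v (hS' hv)
    have h3 := hA v
    have h4 := hB v
    simp only [pot, max_def]
    rw [if_neg h1]
    split_ifs <;> omega
  by_cases h12 : ∃ v ∈ S', 0 ≤ b v - B v ∨ a v - A v < 0
  · have h1 := hB'.2 h12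
    have h2 := Finset.sum_le_sum hdrop
    omega
  push Not at h12
  by_cases hall : ∀ v ∈ S', b v < 0
  · have h1 := (h.crit.2 S' (hS'.trans_ssubset hSU)).of_neg h.edge hall s (fun v => b v - B v)
    have h2 : Col D s S' (fun v => a v - A v) fun v => b v - B v := by
      obtain ⟨f, l, h3, h4, h5⟩ := h1
      refine ⟨f, l, h3, h4, fun v hv => (h5 v hv).trans (le_of_eq ?_)⟩
      have h6 := (hAb v (hS' hv)).resolve_left (hall v hv).not_ge
      simp [h6]
    exact absurd h2 hc.1
  push Not at hall
  obtain ⟨v, hv, hbv⟩ := hall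
  have h1 := hB'.1
  have h2 : ∑ w ∈ S', (pot (a w) (b w) - pot (a w - A w) (b w - B w)) ≤
      ∑ w ∈ S', (4 * A w + 3 * B w - if w = v then 3 else 0) := by
    refine Finset.sum_le_sum fun w hw => ?_
    split_ifs with hwv
    · subst hwv
      have h3 := h12 w hw
      have h4 := hA w
      have h5 := hB w
      simp only [pot, max_def]
      split_ifs <;> omega
    · simpa using hdrop w hw
  rw [Finset.sum_sub_distrib (f := fun w => 4 * A w + 3 * B w), Finset.sum_ite_eq' S' v,
    if_pos hv] at h2
  omega

theorem not_col_singleton (hE : EdgeData D s) {x : V} (h : ¬ Col D s {x} a b) :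
    a x < 0 ∧ b x < 0 := by
  by_contra hx
  refine h ⟨fun w => decide (0 ≤ a w), fun _ _ => 0, by simp, by simp, ?_⟩
  simp only [Finset.mem_singleton, Finset.sum_singleton, forall_eq, if_true, hE.D_self]
  by_cases h2 : 0 ≤ a x <;> simp [h2]
  omega

/-- If the vertex `x` can be colored after each coloring of the rest which is frugal enough near
`x`, then the rest contains a set of small potential. -/
theorem Ctx.removal (h : Ctx D s U a b) {x : V} (hx : x ∈ U) {A B : V → ℤ}
    (hA : ∀ v, 0 ≤ A v) (hB : ∀ v, 0 ≤ B v) (hAs : ∀ v, A v ≤ s x v) (hBs : ∀ v, B v ≤ s x v)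
    (hAb : ∀ v ∈ U.erase x, 0 ≤ b v ∨ A v = 0)
    (hcnt : ∀ f : V → Bool,
      a x < ∑ w ∈ U.erase x, (if f w then 5 * D x w else s x w - B w) →
      b x < ∑ w ∈ U.erase x, (if f w then s x w - A w else D x w) → False) :
    ∃ S' ⊆ U.erase x, S'.Nonempty ∧
      rho D s S' a b ≤ -12 + 2 * ∑ v ∈ S', (4 * A v + 3 * (D x v + B v)) := by
  refine h.exists_le_of_not_col (Finset.erase_ssubset hx) hA
    (fun v => add_nonneg (h.edge.D_nonneg x v) (hB v)) hAb ?_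
  rintro ⟨f, l, hl0, hl1, hl2⟩
  have hf : IsCol D s (U.erase x) a b f l := by
    refine ⟨hl0, hl1, fun v hv => (hl2 v hv).trans ?_⟩
    have := hA v
    have := hB v
    have := h.edge.D_nonneg x v
    split_ifs <;> linarith
  have hk : Allow D s (U.erase x) {x} a b f l (fun w v => if f w then 0 else D w v)
      (fun w v => if v = x then if f w then A w else B w else 0) := by
    refine ⟨fun u v => ?_, fun u v => ?_, fun u v => ?_, fun u v => ?_, fun w hw => ?_⟩
    · have := h.edge.D_nonneg u v
      split_ifs <;> linarith
    · have := hA u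
      have := hB u
      split_ifs <;> linarith
    · have := h.edge.D_nonneg u v
      split_ifs <;> linarith
    · split_ifs with h1 h2
      · rw [h1, h.edge.s_symm]
        exact hAs u
      · rw [h1, h.edge.s_symm]
        exact hBs u
      · exact h.edge.s_nonneg u v
    · have := hl2 w hw
      rw [Finset.sum_singleton, if_pos rfl, h.edge.D_symm w x]
      split_ifs at this ⊢ <;> linarith
  have hnc : ¬ Col D s {x} _ _ := fun hc => h.crit.1 (by
    have := col_union h.edge h.a_le h.b_le (by simp) hf hk hc
    rwa [Finset.union_comm, ← Finset.insert_eq, Finset.insert_erase hx] at this)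
  obtain ⟨h1, h2⟩ := not_col_singleton h.edge hnc
  refine hcnt f ?_ ?_
  · rw [redA, sub_neg] at h1
    refine h1.trans_le (Finset.sum_le_sum fun w _ => ?_)
    rw [h.edge.D_symm x w, h.edge.s_symm x w]
    split_ifs <;> simp_all
  · rw [redB, sub_neg] at h2
    refine h2.trans_le (Finset.sum_le_sum fun w _ => ?_)
    rw [h.edge.D_symm x w, h.edge.s_symm x w]
    split_ifs <;> first | simp_all; done | (simp_all; linarith)

theorem sum_erase_D (hE : EdgeData D s) (x : V) : ∑ w ∈ U.erase x, D x w = ∑ w ∈ U, D x w :=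
  Finset.sum_erase _ (hE.D_self x)

theorem sum_erase_s (hE : EdgeData D s) (x : V) : ∑ w ∈ U.erase x, s x w = ∑ w ∈ U, s x w :=
  Finset.sum_erase _ (hE.s_self x)

theorem EdgeData.D_eq (hE : EdgeData D s) (u v : V) : D u v = 0 ∨ D u v = 1 := by
  have := hE.D_nonneg u v
  have := hE.D_le u v
  omega

theorem col_insert (hE : EdgeData D s) (ha : ∀ v, a v ≤ 1) (hb : ∀ v, b v ≤ 3) {u : V}
    (hu : u ∈ U) {f : V → Bool} {l kD kS : V → V → ℤ} (hf : IsCol D s (U.erase u) a b f l)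
    (hk : Allow D s (U.erase u) {u} a b f l kD kS)
    (h : 0 ≤ redA D s (U.erase u) f kD kS a u ∨ 0 ≤ redB D s (U.erase u) f kD kS b u) :
    Col D s U a b := by
  have hc : Col D s {u} (redA D s (U.erase u) f kD kS a) (redB D s (U.erase u) f kD kS b) := by
    by_contra hc
    have := not_col_singleton hE hc
    omega
  have := col_union hE ha hb (by simp) hf hk hc
  rwa [Finset.union_comm, ← Finset.insert_eq, Finset.insert_erase hu] at this

/-- A coloring of `U - u` in which a soft edge between the neighbours `y` and `z` of a vertex `u`
of degree two could be added extends to `u`. -/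
theorem col_of_suppress (hE : EdgeData D s) (ha : ∀ v, a v ≤ 1) (hb : ∀ v, b v ≤ 3) {u y z : V}
    (hu : u ∈ U) (hau : a u = 1) (hbu : b u = 3) (hs0 : ∀ w ∈ U, s u w = 0)
    (hyz : y ≠ z) (hy : y ∈ U.erase u) (hz : z ∈ U.erase u) (hDy : D u y = 1)
    (hD : ∀ w ∈ U, w ≠ y → w ≠ z → D u w = 0) {f : V → Bool} {l : V → V → ℤ}
    (hf : IsCol D s (U.erase u) a b f l) (hfyz : f y ≠ f z) (hl1 : 1 ≤ l y z)
    (hl2 : s y z + 1 ≤ l y z + l z y) : Col D s U a b := by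
  obtain ⟨h1, h2, h3⟩ := hf
  obtain ⟨l', hl'⟩ : ∃ l' : V → V → ℤ, ∀ p q, l' p q = l p q - if p = y ∧ q = z then 1 else 0 :=
    ⟨_, fun _ _ => rfl⟩
  have hll : ∀ p q, l' p q ≤ l p q := fun p q => by
    rw [hl']
    split_ifs <;> linarith
  have hf' : IsCol D s (U.erase u) a b f l' := by
    refine ⟨fun p q => ?_, fun p hp q hq hpq => ?_, fun v hv => ?_⟩
    · have := h1 p q
      rw [hl']
      split_ifs with h
      · obtain ⟨rfl, rfl⟩ := h
        linarith
      · linarith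
    · have h4 := h2 p hp q hq hpq
      rw [hl', hl']
      by_cases h5 : p = y ∧ q = z
      · obtain ⟨rfl, rfl⟩ := h5
        rw [if_pos ⟨rfl, rfl⟩, if_neg fun h => hyz h.2]
        linarith
      · by_cases h6 : q = y ∧ p = z
        · obtain ⟨rfl, rfl⟩ := h6
          rw [if_neg h5, if_pos ⟨rfl, rfl⟩, hE.s_symm]
          linarith
        · rw [if_neg h5, if_neg h6]
          linarith
    · refine le_trans (Finset.sum_le_sum fun w _ => ?_) (h3 v hv)
      split_ifs
      exacts [le_rfl, hll v w]
  have hroom : (∑ w ∈ U.erase u, if f w = f y then D y w else l' y w) + 1 ≤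
      if f y then a y else b y := by
    refine le_trans (le_of_eq ?_) (h3 y hy)
    rw [← Finset.add_sum_erase _ _ hz, ← Finset.add_sum_erase (U.erase u) (fun w =>
      if f w = f y then D y w else l y w) hz, if_neg hfyz.symm, if_neg hfyz.symm, hl',
      if_pos ⟨rfl, rfl⟩]
    have : ∑ w ∈ (U.erase u).erase z, (if f w = f y then D y w else l' y w) =
        ∑ w ∈ (U.erase u).erase z, if f w = f y then D y w else l y w := by
      refine Finset.sum_congr rfl fun w hw => ?_
      rw [hl', if_neg fun h : y = y ∧ w = z => Finset.ne_of_mem_erase hw h.2, sub_zero]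
    rw [this]
    ring
  have hk : Allow D s (U.erase u) {u} a b f l' (fun w v => if w = y ∧ v = u then 1 else 0)
      (fun _ _ => 0) := by
    refine ⟨fun p q => ?_, fun _ _ => le_rfl, fun p q => ?_, hE.s_nonneg, fun w hw => ?_⟩
    · split_ifs <;> norm_num
    · split_ifs with h
      · rw [h.1, h.2, hE.D_symm, hDy]
      · exact hE.D_nonneg _ _
    · rw [Finset.sum_singleton]
      by_cases hwy : w = y
      · subst hwy
        simpa using hroom
      · simpa [hwy] using hf'.2.2 w hw
  refine col_insert hE ha hb hu hf' hk ?_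
  have hsum : ∀ c d : ℤ, c ≤ 1 → d ≤ 0 →
      ∑ w ∈ U.erase u, (if w = y then c else if w = z then d else 0) ≤ 1 := by
    intro c d hc hd
    rw [← Finset.add_sum_erase _ _ hy, if_pos rfl]
    have : ∑ w ∈ (U.erase u).erase y, (if w = y then c else if w = z then d else 0) ≤ 0 := by
      refine Finset.sum_nonpos fun w hw => ?_
      rw [if_neg (Finset.ne_of_mem_erase hw)]
      split_ifs <;> linarith
    linarith
  have hzero := hsum 1 0 le_rfl le_rfl
  cases hfy : f y
  · have hfz : f z = true := by
      cases h : f z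
      · exact absurd (hfy.trans h.symm) hfyz
      · rfl
    right
    rw [redB, hbu]
    refine (sub_nonneg.2 ((Finset.sum_le_sum fun w hw => ?_).trans (hzero.trans (by norm_num))))
    have hwU := Finset.mem_of_mem_erase hw
    rw [hE.s_symm, hs0 w hwU, hE.D_symm]
    by_cases h1 : w = y
    · subst h1
      simp [hfy, hDy]
    · by_cases h2 : w = z
      · subst h2
        simp [hfz, h1]
      · simp [h1, h2, hD w hwU h1 h2]
  · have hfz : f z = false := by
      cases h : f z
      · rfl
      · exact absurd (hfy.trans h.symm) hfyz
    left
    rw [redA, hau]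
    refine (sub_nonneg.2 ((Finset.sum_le_sum fun w hw => ?_).trans hzero))
    have hwU := Finset.mem_of_mem_erase hw
    rw [hE.s_symm, hs0 w hwU, hE.D_symm]
    by_cases h1 : w = y
    · subst h1
      simp [hfy, hDy]
    · by_cases h2 : w = z
      · subst h2
        simp [hfz, h1]
      · simp [h1, h2, hD w hwU h1 h2]

/-- No vertex of full capacity has exactly two ordinary edges and nothing else. -/
theorem Ctx.not_two (h : Ctx D s U a b) {u : V} (hu : u ∈ U) (hau : a u = 1) (hbu : b u = 3)
    (hs : ∑ w ∈ U, s u w = 0) : ∑ w ∈ U, D u w ≠ 2 := by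
  intro hD
  have hE := h.edge
  have hs0 : ∀ w ∈ U, s u w = 0 :=
    (Finset.sum_eq_zero_iff_of_nonneg fun _ _ => hE.s_nonneg _ _).1 hs
  obtain ⟨y, hy, hDy⟩ : ∃ y ∈ U, D u y = 1 := by
    by_contra! hall
    rw [Finset.sum_eq_zero fun w hw => (hE.D_eq u w).resolve_right (hall w hw)] at hD
    omega
  obtain ⟨z, hz, hyz, hDz⟩ : ∃ z ∈ U, y ≠ z ∧ D u z = 1 := by
    by_contra! hall
    rw [Finset.sum_eq_single y (fun w hw hwu => (hE.D_eq u w).resolve_right (hall w hw hwu.symm))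
      (fun h => absurd hy h), hDy] at hD
    omega
  have hDw : ∀ w ∈ U, w ≠ y → w ≠ z → D u w = 0 := by
    intro w hw h1 h2
    rw [← Finset.add_sum_erase _ _ hy, ← Finset.add_sum_erase _ _
      (Finset.mem_erase.2 ⟨hyz.symm, hz⟩), ← Finset.add_sum_erase _ _
      (Finset.mem_erase.2 ⟨h2, Finset.mem_erase.2 ⟨h1, hw⟩⟩), hDy, hDz] at hD
    have h3 : 0 ≤ ∑ x ∈ ((U.erase y).erase z).erase w, D u x :=
      Finset.sum_nonneg fun _ _ => hE.D_nonneg _ _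
    have := hE.D_nonneg u w
    omega
  have huy : u ≠ y := by
    rintro rfl
    rw [hE.D_self] at hDy
    omega
  have huz : u ≠ z := by
    rintro rfl
    rw [hE.D_self] at hDz
    omega
  have hy' : y ∈ U.erase u := Finset.mem_erase.2 ⟨huy.symm, hy⟩
  have hz' : z ∈ U.erase u := Finset.mem_erase.2 ⟨huz.symm, hz⟩
  obtain ⟨s', hs'⟩ : ∃ s' : V → V → ℤ, ∀ p q, s' p q =
    s p q + if (p = y ∧ q = z) ∨ (p = z ∧ q = y) then 1 else 0 := ⟨_, fun _ _ => rfl⟩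
  have hE' : EdgeData D s' := by
    refine ⟨hE.D_symm, fun p q => ?_, hE.D_self, fun p => ?_, hE.D_nonneg, hE.D_le, fun p q => ?_⟩
    · rw [hs', hs', hE.s_symm]
      congr 1
      refine if_congr ?_ rfl rfl
      tauto
    · rw [hs', hE.s_self, if_neg, add_zero]
      rintro (⟨rfl, h⟩ | ⟨rfl, h⟩)
      exacts [hyz h, hyz h.symm]
    · have := hE.s_nonneg p q
      rw [hs']
      split_ifs <;> linarith
  have hnc : ¬ Col D s' (U.erase u) a b := by
    rintro ⟨f, l, h1, h2, h3⟩
    have hf : IsCol D s (U.erase u) a b f l := by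
      refine ⟨h1, fun p hp q hq hpq => le_trans ?_ (h2 p hp q hq hpq), h3⟩
      rw [hs']
      split_ifs <;> linarith
    refine h.crit.1 ?_
    by_cases hfyz : f y = f z
    · refine col_insert hE h.a_le h.b_le hu hf (allow_zero hE _ hf) ?_
      cases hfy : f y
      · left
        rw [redA, hau, Finset.sum_eq_zero, sub_zero]
        · norm_num
        · intro w hw
          have hwU := Finset.mem_of_mem_erase hw
          rw [hE.s_symm, hs0 w hwU, hE.D_symm]
          by_cases h1 : w = y
          · subst h1
            simp [hfy]
          · by_cases h2 : w = z
            · subst h2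
              simp [← hfyz, hfy]
            · simp [hDw w hwU h1 h2]
      · right
        rw [redB, hbu, Finset.sum_eq_zero, sub_zero]
        · norm_num
        · intro w hw
          have hwU := Finset.mem_of_mem_erase hw
          rw [hE.s_symm, hs0 w hwU, hE.D_symm]
          by_cases h1 : w = y
          · subst h1
            simp [hfy]
          · by_cases h2 : w = z
            · subst h2
              simp [← hfyz, hfy]
            · simp [hDw w hwU h1 h2]
    · have h4 := h2 y hy' z hz' hfyz
      rw [hs', if_pos (Or.inl ⟨rfl, rfl⟩)] at h4
      by_cases h5 : 1 ≤ l y z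
      · exact col_of_suppress hE h.a_le h.b_le hu hau hbu hs0 hyz hy' hz' hDy hDw hf hfyz h5 h4
      · have h6 := hE.s_nonneg y z
        refine col_of_suppress hE h.a_le h.b_le hu hau hbu hs0 hyz.symm hz' hy' hDz
          (fun w hw h1 h2 => hDw w hw h2 h1) hf (fun h => hfyz h.symm) (by omega) ?_
        rw [hE.s_symm]
        omega
  obtain ⟨S', hS', hc⟩ := exists_crit hnc
  have huS : u ∉ S' := fun hh => (Finset.mem_erase.1 (hS' hh)).1 rfl
  have hSU : S' ⊂ U := hS'.trans_ssubset (Finset.erase_ssubset hu)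
  have hB := h.ih D s' S' a b (Finset.card_lt_card hSU) hE' h.a_le h.b_le hc
  by_cases hyzS : y ∈ S' ∧ z ∈ S'
  · obtain ⟨hyS, hzS⟩ := hyzS
    have hr : rho D s' S' a b = rho D s S' a b - 8 := by
      have h1 : ∀ p q, 9 * D p q + 4 * s' p q = 9 * D p q + 4 * s p q +
          ((if p = y then if q = z then 4 else 0 else 0) +
            if p = z then if q = y then 4 else 0 else 0) := by
        intro p q
        rw [hs', ← ite_and, ← ite_and]
        by_cases h2 : p = y ∧ q = z
        · have h3 : ¬ (p = z ∧ q = y) := fun h => hyz (h2.1.symm.trans h.1)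
          simp only [h2, true_or, if_true, and_self]
          ring_nf
          simp [hyz]
        · by_cases h3 : p = z ∧ q = y
          · simp only [h3, or_true, if_true, and_self]
            ring_nf
            simp [hyz.symm]
          · simp only [h2, h3, or_self, if_false]
            ring
      simp only [rho, h1]
      simp only [Finset.sum_add_distrib, Finset.sum_ite_irrel, Finset.sum_ite_eq', hyS, hzS,
        if_true, Finset.sum_const_zero]
      ring
    have hr2 : rho D s (insert u S') a b = rho D s S' a b - 8 := by
      have h1 : ∑ w ∈ S', D u w = 2 := by
        rw [← hD]
        refine Finset.sum_subset hSU.1 fun w hw hwS => hDw w hw ?_ ?_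
        · rintro rfl
          exact hwS hyS
        · rintro rfl
          exact hwS hzS
      have h2 : ∑ w ∈ S', s u w = 0 := Finset.sum_eq_zero fun w hw => hs0 w (hSU.1 hw)
      rw [rho_insert hE huS, h1, h2, hau, hbu]
      norm_num [pot]
      ring
    by_cases hU : insert u S' = U
    · have hlt := h.lt
      have hneg : ∀ v ∈ S', b v < 0 := by
        intro v hv
        by_contra! hbv
        have := hB.2 ⟨v, hv, Or.inl hbv⟩
        rw [hU] at hr2
        omega
      exact hc.1 ((h.crit.2 S' hSU).of_neg hE hneg s' b)
    · have h1 := h.weak_gap (Finset.insert_nonempty u S')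
        ((Finset.insert_subset hu hSU.1).ssubset_of_ne hU)
      have h2 := h.lt
      have h3 := hB.1
      omega
  · refine hc.1 ?_
    obtain ⟨f, l, h1, h2, h3⟩ := h.crit.2 S' hSU
    refine ⟨f, l, h1, fun p hp q hq hpq => ?_, h3⟩
    rw [hs', if_neg, add_zero]
    · exact h2 p hp q hq hpq
    · rintro (⟨rfl, rfl⟩ | ⟨rfl, rfl⟩)
      exacts [hyzS ⟨hp, hq⟩, hyzS ⟨hq, hp⟩]

theorem Ctx.degree_ge (h : Ctx D s U a b) {x : V} (hx : x ∈ U) :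
    b x + 1 ≤ ∑ w ∈ U, D x w + ∑ w ∈ U, s x w ∧
      (0 ≤ a x → b x + 2 ≤ ∑ w ∈ U, D x w + ∑ w ∈ U, s x w) := by
  have hE := h.edge
  rw [← sum_erase_D hE, ← sum_erase_s hE]
  by_contra hcon
  obtain ⟨S', hS', hne, hr⟩ := h.removal hx (A := fun _ => 0) (B := fun _ => 0) (fun _ => le_rfl)
    (fun _ => le_rfl) (hE.s_nonneg x) (hE.s_nonneg x) (fun _ _ => Or.inr rfl) (by
      intro f h1 h2
      have h3 : ∑ w ∈ U.erase x, (if f w then s x w - 0 else D x w) +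
          ∑ w ∈ U.erase x, (if f w then D x w else s x w) =
          ∑ w ∈ U.erase x, D x w + ∑ w ∈ U.erase x, s x w := by
        rw [← Finset.sum_add_distrib, ← Finset.sum_add_distrib]
        refine Finset.sum_congr rfl fun w _ => ?_
        split_ifs <;> ring
      have h4 : ∑ w ∈ U.erase x, (if f w then 5 * D x w else s x w - 0) ≤
          ∑ w ∈ U.erase x, 5 * (if f w then D x w else s x w) := by
        refine Finset.sum_le_sum fun w _ => ?_
        have := hE.s_nonneg x w
        split_ifs <;> linarith
      rw [← Finset.mul_sum] at h4
      have h5 : 0 ≤ ∑ w ∈ U.erase x, (if f w then D x w else s x w) := by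
        refine Finset.sum_nonneg fun w _ => ?_
        split_ifs
        exacts [hE.D_nonneg _ _, hE.s_nonneg _ _]
      omega)
  have hxS : x ∉ S' := fun hh => (Finset.mem_erase.1 (hS' hh)).1 rfl
  have hSU : S' ⊂ U := hS'.trans_ssubset (Finset.erase_ssubset hx)
  have h1 := h.weak_gap hne hSU
  have h2 := rho_insert (a := a) (b := b) hE hxS
  have h3 : ∑ v ∈ S', (4 * (0 : ℤ) + 3 * (D x v + 0)) = 3 * ∑ v ∈ S', D x v := by
    rw [Finset.mul_sum]
    exact Finset.sum_congr rfl fun _ _ => by ring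
  rw [h3] at hr
  have h4 := h.lt
  have h5 : 0 ≤ ∑ w ∈ S', s x w := Finset.sum_nonneg fun _ _ => hE.s_nonneg _ _
  have h6 : pot (a x) (b x) ≤ 14 := by
    have := h.a_le x
    have := h.b_le x
    simp only [pot, max_def]
    split_ifs <;> omega
  have h9 : 2 ≤ ∑ w ∈ S', D x w := by omega
  by_cases hU : insert x S' = U
  · have hSe : S' = U.erase x := by rw [← hU, Finset.erase_insert hxS]
    rw [hU] at h2
    have h7 : a x = 1 ∧ b x = 3 := by
      have := h.a_le x
      have := h.b_le x
      simp only [pot, max_def] at h2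
      constructor <;> split_ifs at h2 <;> omega
    rw [h7.1, h7.2] at h2
    norm_num [pot] at h2
    refine h.not_two hx h7.1 h7.2 ?_ ?_
    · rw [← sum_erase_s hE, ← hSe]
      omega
    · rw [← sum_erase_D hE, ← hSe]
      omega
  · have h8 := h.weak_gap (Finset.insert_nonempty x S')
      ((Finset.insert_subset hx hSU.1).ssubset_of_ne hU)
    omega

theorem exists_sum_eq {g : V → ℤ} (hg : ∀ v, 0 ≤ g v) (W : Finset V) {k : ℤ} (hk0 : 0 ≤ k)
    (hk : k ≤ ∑ v ∈ W, g v) :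
    ∃ A : V → ℤ, (∀ v, 0 ≤ A v) ∧ (∀ v, A v ≤ g v) ∧ ∑ v ∈ W, A v = k := by
  induction W using Finset.induction_on generalizing k with
  | empty => exact ⟨fun _ => 0, fun _ => le_rfl, hg, by simp at hk ⊢; omega⟩
  | insert x W hx ih =>
    rw [Finset.sum_insert hx] at hk
    obtain ⟨A, h1, h2, h3⟩ := ih (k := max (k - g x) 0) (le_max_right _ _)
      (max_le (by linarith) (Finset.sum_nonneg fun _ _ => hg _))
    refine ⟨fun v => if v = x then min k (g x) else A v, fun v => ?_, fun v => ?_, ?_⟩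
    · dsimp only
      split_ifs
      exacts [le_min hk0 (hg x), h1 v]
    · dsimp only
      split_ifs with h
      exacts [h ▸ min_le_right _ _, h2 v]
    · rw [Finset.sum_insert hx, if_pos rfl, Finset.sum_congr rfl fun w hw =>
        if_neg (ne_of_mem_of_not_mem hw hx), h3]
      omega

theorem Col.mono {a' b' : V → ℤ} (h : Col D s T a b) (ha : ∀ v ∈ T, a v ≤ a' v)
    (hb : ∀ v ∈ T, b v ≤ b' v) : Col D s T a' b' := by
  obtain ⟨f, l, h1, h2, h3⟩ := h
  refine ⟨f, l, h1, h2, fun v hv => (h3 v hv).trans ?_⟩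
  have := ha v hv
  have := hb v hv
  split_ifs <;> assumption

theorem gn_eq_zero {f : V → Bool} {l kD kS : V → V → ℤ} {W : Finset V}
    (hk : Allow D s S W a b f l kD kS) {w v : V} (hw : f w = true)
    (h : gn D s f kD kS w v ≤ 0) : D w v = 0 ∧ s w v = 0 ∧ kD w v = 0 ∧ kS w v = 0 := by
  have h1 := hk.kD_nonneg w v
  have h2 := hk.kS_nonneg w v
  have h3 := hk.kD_le w v
  have h4 := hk.kS_le w v
  rw [gn, if_pos hw] at h
  omega

/-- Coloring first a single vertex `v` which must have color `true`. -/
theorem Ctx.peel (h : Ctx D s U a b) {v : V} (hv : v ∈ U) (hav : 0 ≤ a v) (hbv : b v < 0)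
    {kD kS : V → V → ℤ} (hk : Allow D s {v} (U \ {v}) a b (fun _ => true) (fun _ _ => 0) kD kS) :
    ∃ T ⊆ U.erase v, T.Nonempty ∧ 1 ≤ ∑ y ∈ T, gn D s (fun _ => true) kD kS v y ∧
      ((∃ y, T = {y} ∧ a y - (5 * D v y - 4 * kD v y) < 0 ∧ b y - (s v y - kS v y) < 0) ∨
      rho D s (insert v T) a b ≤
        2 * pot (a v) (b v) - 6 - 2 * ∑ y ∈ T, gn D s (fun _ => true) kD kS v y ∧
      (insert v T = U → rho D s U a b ≤
        2 * pot (a v) (b v) - 12 - 2 * ∑ y ∈ T, gn D s (fun _ => true) kD kS v y)) := by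
  have hE := h.edge
  have hf : IsCol D s {v} a b (fun _ => true) (fun _ _ => 0) := by
    simp [IsCol, hE.D_self, hav]
  obtain ⟨T, hT, hc, hB⟩ := h.exists_crit_red (Finset.singleton_nonempty v)
    (h.ssubset_singleton hv) hf hk
  have hA : ∀ y, redA D s {v} (fun _ => true) kD kS a y = a y - (5 * D v y - 4 * kD v y) := by
    simp [redA]
  have hB' : ∀ y, redB D s {v} (fun _ => true) kD kS b y = b y - (s v y - kS v y) := by
    simp [redB]
  have hTe : T ⊆ U.erase v := by rwa [Finset.erase_eq]
  have hTU : T ⊂ U := hTe.trans_ssubset (Finset.erase_ssubset hv)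
  have hvT : v ∉ T := fun hh => (Finset.mem_erase.1 (hTe hh)).1 rfl
  refine ⟨T, hTe, hc.nonempty, ?_, ?_⟩
  · by_contra! hlt
    refine hc.1 ((h.crit.2 T hTU).mono ?_ ?_) <;> intro y hy <;>
      obtain ⟨h1, h2, h3, h4⟩ := gn_eq_zero hk (w := v) (v := y) rfl
        ((Finset.single_le_sum (f := fun y => gn D s (fun _ => true) kD kS v y)
          (fun _ _ => hk.gn_nonneg _ _) hy).trans (by omega))
    · rw [hA, h1, h3]
      simp
    · rw [hB', h2, h4]
      simp
  by_cases hT1 : ∃ y, T = {y} ∧ a y - (5 * D v y - 4 * kD v y) < 0 ∧ b y - (s v y - kS v y) < 0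
  · exact Or.inl hT1
  right
  have hr := rho_union_exc (S := {v}) (T := T) (a := a) (b := b) hE (by simpa using hvT)
    (redA D s {v} (fun _ => true) kD kS a) (redB D s {v} (fun _ => true) kD kS b)
  rw [rho_singleton hE, ← Finset.insert_eq] at hr
  have hge : ∀ y ∈ T, gn D s (fun _ => true) kD kS v y ≤ exc D s {v} a b
      (redA D s {v} (fun _ => true) kD kS a) (redB D s {v} (fun _ => true) kD kS b) y := by
    intro y hy
    have := (hk.le_exc h.a_le h.b_le y).1 fun hh => hT1 ⟨y, hc.eq_singleton hE hy hh.1 hh.2, by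
      rwa [hA, hB'] at hh⟩
    simpa using this
  have h1 := Finset.sum_le_sum hge
  have h2 := hB.1
  refine ⟨by omega, fun hU => ?_⟩
  rw [hU] at hr
  by_cases h3 : ∃ y ∈ T, 0 ≤ redB D s {v} (fun _ => true) kD kS b y ∨
    redA D s {v} (fun _ => true) kD kS a y < 0
  · have := hB.2 h3
    omega
  push Not at h3
  obtain ⟨w, hwU, hbw⟩ := h.exists_b
  have hw : w ∈ T := by
    rw [← hU] at hwU
    refine (Finset.mem_insert.1 hwU).resolve_left ?_
    rintro rfl
    omega
  have h4 : ∑ y ∈ T, (gn D s (fun _ => true) kD kS v y + if y = w then 3 else 0) ≤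
      ∑ y ∈ T, exc D s {v} a b (redA D s {v} (fun _ => true) kD kS a)
        (redB D s {v} (fun _ => true) kD kS b) y := by
    refine Finset.sum_le_sum fun y hy => ?_
    split_ifs with hyw
    · subst hyw
      obtain ⟨h5, h6⟩ := h3 y hy
      have h7 := hk.kD_le v y
      have h8 := hk.kS_le v y
      have h9 := hk.kD_nonneg v y
      have h10 := hk.kS_nonneg v y
      have h11 := h.a_le y
      rw [hB'] at h5
      rw [hA] at h6
      simp only [exc, gn, hA, hB', Finset.sum_singleton, if_true, pot, max_def]
      obtain h12 | h12 := hE.D_eq v y <;> rw [h12] at h6 h7 ⊢ <;> split_ifs <;> omega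
    · simpa using hge y hy
  rw [Finset.sum_add_distrib, Finset.sum_ite_eq' T w, if_pos hw] at h4
  omega

/-- An allowance at the single edge from `v` to `y`. -/
theorem allow_single (hE : EdgeData D s) {v : V} (hav : 0 ≤ a v) (W : Finset V) (y : V) {c d : ℤ}
    (hc : 0 ≤ c) (hd : 0 ≤ d) (hcD : c ≤ D v y) (hds : d ≤ s v y) (hcd : c + d ≤ a v) :
    Allow D s {v} W a b (fun _ => true) (fun _ _ => 0)
      (fun p q => if p = v ∧ q = y then c else 0) fun p q => if p = v ∧ q = y then d else 0 := by
  refine ⟨fun p q => ?_, fun p q => ?_, fun p q => ?_, fun p q => ?_, fun w hw => ?_⟩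
  · split_ifs <;> omega
  · split_ifs <;> omega
  · split_ifs with hpq
    exacts [hpq.1 ▸ hpq.2 ▸ hcD, hE.D_nonneg _ _]
  · split_ifs with hpq
    exacts [hpq.1 ▸ hpq.2 ▸ hds, hE.s_nonneg _ _]
  · obtain rfl := Finset.mem_singleton.1 hw
    simp only [Finset.sum_singleton, if_true, hE.D_self, true_and, Finset.sum_add_distrib,
      Finset.sum_ite_eq']
    split_ifs <;> omega

theorem Ctx.not_zero_neg (h : Ctx D s U a b) {v : V} (hv : v ∈ U) (hbv : b v < 0) :
    a v = 1 := by
  have hE := h.edge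
  have hlt := h.lt
  have h0 : 0 ≤ a v := by
    have := h.not_both_neg hv
    omega
  by_contra ha1
  have hav : a v = 0 := by
    have := h.a_le v
    omega
  obtain ⟨T, hT, hne, hg, hT'⟩ := h.peel hv h0 hbv (allow_single hE h0 _ v le_rfl le_rfl
    (hE.D_nonneg _ _) (hE.s_nonneg _ _) (by simpa using h0))
  have hvT : v ∉ T := fun hh => (Finset.mem_erase.1 (hT hh)).1 rfl
  have hpot : pot (a v) (b v) = 1 := by
    simp [pot, hav, hbv.le]
  have hgap : insert v T ≠ U → -6 < rho D s (insert v T) a b := fun hU => by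
    have := h.weak_gap (Finset.insert_nonempty v T) ((Finset.insert_subset hv (hT.trans
      (Finset.erase_subset _ _))).ssubset_of_ne hU)
    omega
  rcases hT' with ⟨y, rfl, h1, h2⟩ | ⟨h1, h2⟩
  · rw [rho_insert hE hvT, rho_singleton hE, hpot] at hgap
    simp only [ite_self, mul_zero, sub_zero, Finset.sum_singleton] at h1 h2 hgap
    have hvy : v ≠ y := by simpa using hvT
    have hU' : insert v {y} = U → 0 ≤ b y ∧ rho D s U a b =
        2 * pot (a y) (b y) + 2 - 18 * D v y - 8 * s v y := by
      rintro rfl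
      obtain ⟨w, hw, hbw⟩ := h.exists_b
      rw [rho_insert hE hvT, rho_singleton hE, hpot]
      simp only [Finset.mem_insert, Finset.mem_singleton] at hw
      refine ⟨?_, by simp⟩
      rcases hw with rfl | rfl <;> omega
    have h3 := h.a_le y
    have h4 := h.not_both_neg (Finset.mem_of_mem_erase (hT (Finset.mem_singleton_self y)))
    have h5 := hE.s_nonneg v y
    simp only [pot, max_def] at hgap hU'
    rw [if_neg h4] at hgap hU'
    by_cases hU : insert v {y} = U
    · obtain ⟨h6, h7⟩ := hU' hU
      clear hgap hU'
      obtain h12 | h12 := hE.D_eq v y <;> rw [h12] at h1 h7 <;> split_ifs at h7 <;> omega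
    · have h6 := hgap hU
      clear hgap hU'
      obtain h12 | h12 := hE.D_eq v y <;> rw [h12] at h1 h6 <;> split_ifs at h6 <;> omega
  · rw [hpot] at h1 h2
    by_cases hU : insert v T = U
    · have := h2 hU
      omega
    · have := hgap hU
      omega

theorem Ctx.neg_degree (h : Ctx D s U a b) {v : V} (hv : v ∈ U) (hbv : b v < 0) :
    2 ≤ ∑ w ∈ U, D v w ∨ (1 ≤ ∑ w ∈ U, D v w ∧ 1 ≤ ∑ w ∈ U, s v w) ∨ 3 ≤ ∑ w ∈ U, s v w := by
  have hE := h.edge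
  have hlt := h.lt
  have hav := h.not_zero_neg hv hbv
  have hD0 : ∀ w ∈ U, 0 ≤ D v w := fun _ _ => hE.D_nonneg _ _
  have hs0 : ∀ w ∈ U, 0 ≤ s v w := fun _ _ => hE.s_nonneg _ _
  have hDn := Finset.sum_nonneg hD0
  have hsn := Finset.sum_nonneg hs0
  by_contra hcon
  by_cases hj : ∑ w ∈ U, D v w = 0
  · have hDz := (Finset.sum_eq_zero_iff_of_nonneg hD0).1 hj
    obtain ⟨B, hB0, hBs, hB⟩ := exists_sum_eq (hE.s_nonneg v) (U.erase v)
      (k := max (∑ w ∈ U, s v w - 1) 0) (le_max_right _ _) (by rw [sum_erase_s hE]; omega)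
    obtain ⟨S', hS', hne, hr⟩ := h.removal hv (A := fun _ => 0) (B := B) (fun _ => le_rfl) hB0
      (hE.s_nonneg v) hBs (fun _ _ => Or.inr rfl) (by
        intro f h1 _
        have h2 : ∑ w ∈ U.erase v, (if f w then 5 * D v w else s v w - B w) ≤
            ∑ w ∈ U.erase v, (s v w - B w) := by
          refine Finset.sum_le_sum fun w hw => ?_
          have := hBs w
          rw [hDz w (Finset.mem_of_mem_erase hw)]
          split_ifs <;> linarith
        rw [Finset.sum_sub_distrib, hB, sum_erase_s hE] at h2
        omega)
    have h1 := h.weak_gap hne (hS'.trans_ssubset (Finset.erase_ssubset hv))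
    have h2 : ∑ w ∈ S', (4 * (0 : ℤ) + 3 * (D v w + B w)) ≤ 3 * ∑ w ∈ U.erase v, B w := by
      rw [Finset.mul_sum]
      refine (Finset.sum_le_sum fun w hw => ?_).trans (Finset.sum_le_sum_of_subset_of_nonneg hS'
        fun w _ _ => mul_nonneg (by norm_num) (hB0 w))
      rw [hDz w (Finset.mem_of_mem_erase (hS' hw))]
      linarith
    omega
  · have hsz := (Finset.sum_eq_zero_iff_of_nonneg hs0).1 (by omega)
    obtain ⟨y, hy, hvy⟩ : ∃ y ∈ U, D v y = 1 := by
      by_contra! hall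
      exact hj (Finset.sum_eq_zero fun w hw => (hE.D_eq v w).resolve_right (hall w hw))
    have hother : ∀ w ∈ U, w ≠ y → D v w = 0 := by
      intro w hw hwy
      have h1 := Finset.add_sum_erase U (D v) hy
      have h2 := Finset.single_le_sum (f := D v) (fun _ _ => hE.D_nonneg _ _)
        (Finset.mem_erase.2 ⟨hwy, hw⟩)
      have h3 := hE.D_nonneg v w
      omega
    obtain ⟨T, hT, hne, hg, hT'⟩ := h.peel hv (by omega) hbv (allow_single hE (by omega) _ y
      (c := 1) (d := 0) (by norm_num) le_rfl hvy.ge (hE.s_nonneg _ _) (by omega))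
    have hTU := hT.trans (Finset.erase_subset v U)
    have hpot : pot (a v) (b v) = 5 := by
      simp [pot, hav, hbv.le]
    have hgn : ∀ w ∈ T, gn D s (fun _ => true) (fun p q => if p = v ∧ q = y then (1 : ℤ) else 0)
        (fun p q => if p = v ∧ q = y then (0 : ℤ) else 0) v w = if w = y then 5 else 0 := by
      intro w hw
      have h1 := hsz w (hTU hw)
      by_cases hwy : w = y
      · subst hwy
        simp [gn, h1, hvy]
      · simp [gn, h1, hother w (hTU hw) hwy, hwy]
    rw [Finset.sum_congr rfl hgn, Finset.sum_ite_eq'] at hg hT'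
    have hyT : y ∈ T := by
      by_contra hyT
      rw [if_neg hyT] at hg
      omega
    rw [if_pos hyT, hpot] at hT'
    rcases hT' with ⟨y', rfl, h1, h2⟩ | ⟨h1, h2⟩
    · obtain rfl := Finset.mem_singleton.1 hyT
      have h3 := hsz y hy
      simp only [and_self, if_true, hvy, h3] at h1 h2
      have := h.not_zero_neg hy (by omega)
      omega
    · by_cases hU : insert v T = U
      · have := h2 hU
        omega
      · have := h.weak_gap (Finset.insert_nonempty v T)
          ((Finset.insert_subset hv hTU).ssubset_of_ne hU)
        omega

theorem allow_of_slack {A B : V → ℤ} {f : V → Bool} {l kD kS : V → V → ℤ} {W : Finset V}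
    (hf : IsCol D s S (fun v => a v - A v) (fun v => b v - B v) f l)
    (h1 : ∀ u v, 0 ≤ kD u v) (h2 : ∀ u v, 0 ≤ kS u v) (h3 : ∀ u v, kD u v ≤ D u v)
    (h4 : ∀ u v, kS u v ≤ s u v)
    (h5 : ∀ w ∈ S, ∑ v ∈ W, (kD w v + kS w v) ≤ if f w then A w else B w) :
    Allow D s S W a b f l kD kS := by
  refine ⟨h1, h2, h3, h4, fun w hw => ?_⟩
  have h6 := hf.2.2 w hw
  have h7 := h5 w hw
  split_ifs at h6 h7 ⊢ <;> linarith

theorem IsCol.mono {a' b' : V → ℤ} {f : V → Bool} {l : V → V → ℤ} (h : IsCol D s T a b f l)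
    (ha : ∀ v ∈ T, a v ≤ a' v) (hb : ∀ v ∈ T, b v ≤ b' v) : IsCol D s T a' b' f l := by
  refine ⟨h.1, h.2.1, fun v hv => (h.2.2 v hv).trans ?_⟩
  have := ha v hv
  have := hb v hv
  split_ifs <;> assumption

theorem IsCol.of_slack {A B : V → ℤ} {f : V → Bool} {l : V → V → ℤ}
    (h : IsCol D s T (fun v => a v - A v) (fun v => b v - B v) f l)
    (hA : ∀ v, 0 ≤ A v) (hB : ∀ v, 0 ≤ B v) : IsCol D s T a b f l :=
  h.mono (fun v _ => by linarith [hA v]) fun v _ => by linarith [hB v]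

/-- An allowance at the single edge from `w` to `y`. -/
theorem allow_edge (hE : EdgeData D s) {A B : V → ℤ} {f : V → Bool} {l : V → V → ℤ}
    {W : Finset V} (hf : IsCol D s S (fun v => a v - A v) (fun v => b v - B v) f l)
    (hA : ∀ v, 0 ≤ A v) (hB : ∀ v, 0 ≤ B v) {w y : V} {c d : ℤ} (hc : 0 ≤ c) (hd : 0 ≤ d)
    (hcD : c ≤ D w y) (hds : d ≤ s w y) (hcd : c + d ≤ if f w then A w else B w) :
    Allow D s S W a b f l (fun p q => if p = w ∧ q = y then c else 0)
      fun p q => if p = w ∧ q = y then d else 0 := by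
  refine allow_of_slack hf (fun p q => ?_) (fun p q => ?_) (fun p q => ?_) (fun p q => ?_)
    fun p hp => ?_
  · split_ifs <;> omega
  · split_ifs <;> omega
  · split_ifs with hpq
    exacts [hpq.1 ▸ hpq.2 ▸ hcD, hE.D_nonneg _ _]
  · split_ifs with hpq
    exacts [hpq.1 ▸ hpq.2 ▸ hds, hE.s_nonneg _ _]
  · by_cases hpw : p = w
    · subst hpw
      simp only [true_and, Finset.sum_add_distrib, Finset.sum_ite_eq']
      split_ifs at hcd ⊢ <;> omega
    · have := hA p
      have := hB p
      simp only [hpw, false_and, if_false, add_zero, Finset.sum_const_zero]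
      split_ifs <;> assumption

/-- After a subset of least potential is removed, some capacity drops. -/
theorem Ctx.exists_red (h : Ctx D s U a b) (hS : IsMin D s U a b S) {f : V → Bool}
    {l kD kS : V → V → ℤ} (hf : IsCol D s S a b f l) (hk : Allow D s S (U \ S) a b f l kD kS) :
    ∃ w ∈ S, ∃ v ∈ U \ S, 1 ≤ D w v ∨ kS w v < s w v := by
  have hE := h.edge
  by_contra! hall
  refine (h.crit_sdiff hS hf hk).1.1 ((h.crit.2 (U \ S)
    (Finset.sdiff_ssubset hS.ssubset.1 hS.nonempty)).mono ?_ ?_) <;> intro v hv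
  · rw [redA, Finset.sum_eq_zero, sub_zero]
    intro w hw
    obtain ⟨h1, h2⟩ := hall w hw v hv
    have h3 := hk.kD_le w v
    have h4 := hk.kD_nonneg w v
    have h5 := hE.D_nonneg w v
    have h6 := hk.kS_le w v
    split_ifs <;> omega
  · rw [redB, Finset.sum_eq_zero, sub_zero]
    intro w hw
    obtain ⟨h1, h2⟩ := hall w hw v hv
    have h3 := hk.kD_le w v
    have h4 := hk.kD_nonneg w v
    have h5 := hE.D_nonneg w v
    have h6 := hk.kS_le w v
    split_ifs <;> omega

/-- The contribution of a vertex outside `S` to the difference of potentials of `S` and `U`. -/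
def cst (D s : V → V → ℤ) (U S : Finset V) (a b : V → ℤ) (v : V) : ℤ :=
  9 * ∑ w ∈ U \ S, D v w + 4 * ∑ w ∈ U \ S, s v w +
    2 * (9 * ∑ w ∈ S, D w v + 4 * ∑ w ∈ S, s w v) - 2 * pot (a v) (b v)

theorem rho_sub_eq (hE : EdgeData D s) (hSU : S ⊆ U) :
    rho D s S a b - rho D s U a b = ∑ v ∈ U \ S, cst D s U S a b v := by
  have h := rho_union (a := a) (b := b) hE (Finset.disjoint_sdiff (s := S) (t := U))
  rw [Finset.union_sdiff_of_subset hSU] at h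
  rw [h, rho.eq_1 D s (U \ S)]
  simp only [cst, Finset.sum_add_distrib, Finset.sum_sub_distrib, ← Finset.mul_sum]
  ring

theorem sum_split (hSU : S ⊆ U) {g : V → V → ℤ} (hg : ∀ u v, g u v = g v u) (v : V) :
    ∑ w ∈ U, g v w = ∑ w ∈ U \ S, g v w + ∑ w ∈ S, g w v := by
  rw [← Finset.sum_sdiff hSU]
  simp_rw [hg _ v]

theorem cost_of_nonneg {α β N1 N2 H1 H2 Q1 Q2 Z d t : ℤ} (h8 : α ≤ 1)
    (hβ : 0 ≤ β) (h1 : 0 ≤ N1) (h2 : 0 ≤ N2) (h3 : 0 ≤ H1) (h4 : 0 ≤ H2) (h5 : 0 ≤ Q1)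
    (h6 : 0 ≤ Q2) (h7 : 0 ≤ Z) (hd : 0 ≤ d) (ht : 0 ≤ t)
    (hdeg : β + 1 ≤ d + (N1 + N2 + H1 + H2) + (t + (Q1 + Q2 + Z)))
    (hdeg' : 0 ≤ α → β + 2 ≤ d + (N1 + N2 + H1 + H2) + (t + (Q1 + Q2 + Z)))
    (hb : β - (5 * N2 + H2 + Q1) < 0) (h9 : β ≤ 3) {c : ℤ}
    (hc : c = 9 * d + 4 * t + 2 * (9 * (N1 + N2 + H1 + H2) + 4 * (Q1 + Q2 + Z)) - 2 * pot α β) :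
    (1 ≤ d → 7 ≤ c) ∧ (2 ≤ d → 16 ≤ c) ∧ (1 ≤ d → α - (5 * N1 + H1 + Q2) ≤ 0 → 15 ≤ c) ∧
      (α - (5 * N1 + H1 + Q2) < 0 → 14 ≤ c ∧ (1 ≤ H1 + H2 → 22 ≤ c) ∧
        (N1 + N2 + H1 + H2 = 0 → 1 ≤ Z → 22 ≤ c)) := by
  simp only [pot, max_def] at hc
  rw [if_neg (by omega)] at hc
  refine ⟨fun hd => ?_, fun hd => ?_, fun hd ha => ?_, fun ha => ⟨?_, fun hH => ?_,
    fun hN hZ => ?_⟩⟩ <;>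
  · by_cases hN1 : N1 = 0 <;> by_cases hN2 : N2 = 0 <;> split_ifs at hc <;> omega

theorem cost_of_neg {β N1 N2 H1 H2 Q1 Q2 Z d t : ℤ}
    (hβ : β < 0) (h1 : 0 ≤ N1) (h2 : 0 ≤ N2) (h3 : 0 ≤ H1) (h4 : 0 ≤ H2) (h5 : 0 ≤ Q1)
    (h6 : 0 ≤ Q2) (h7 : 0 ≤ Z) (ht : 0 ≤ t)
    (hdeg : 2 ≤ d + (N1 + N2 + H1 + H2) ∨
      (1 ≤ d + (N1 + N2 + H1 + H2) ∧ 1 ≤ t + (Q1 + Q2 + Z)) ∨ 3 ≤ t + (Q1 + Q2 + Z)) {c : ℤ}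
    (hc : c = 9 * d + 4 * t + 2 * (9 * (N1 + N2 + H1 + H2) + 4 * (Q1 + Q2 + Z)) - 2 * pot 1 β) :
    (1 ≤ d → 3 ≤ c ∧ (t = 0 → 7 ≤ c)) ∧ (2 ≤ d → 8 ≤ c) ∧
      (1 ≤ d → 1 - (5 * N1 + H1 + Q2) ≤ 0 → 7 ≤ c ∧ (1 ≤ t → 11 ≤ c)) ∧
      (d = 0 → t = 0 → 1 - (5 * N1 + H1 + Q2) < 0 → 14 ≤ c) := by
  simp only [pot, max_def] at hc
  rw [if_neg (by omega), if_neg (by omega), if_pos (by omega)] at hc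
  by_cases hN : N1 + H1 = 0 <;> omega

theorem Ctx.cst_bounds (h : Ctx D s U a b) (hSU : S ⊆ U) {f : V → Bool} {l kD kS : V → V → ℤ}
    (hk : Allow D s S (U \ S) a b f l kD kS) {v : V} (hv : v ∈ U \ S)
    (hb : redB D s S f kD kS b v < 0) :
    (0 ≤ b v → (1 ≤ ∑ w ∈ U \ S, D v w → 7 ≤ cst D s U S a b v) ∧
      (2 ≤ ∑ w ∈ U \ S, D v w → 16 ≤ cst D s U S a b v) ∧
      (1 ≤ ∑ w ∈ U \ S, D v w → redA D s S f kD kS a v ≤ 0 → 15 ≤ cst D s U S a b v) ∧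
      (redA D s S f kD kS a v < 0 → 14 ≤ cst D s U S a b v ∧
        (1 ≤ ∑ w ∈ S, kD w v → 22 ≤ cst D s U S a b v) ∧
        (∑ w ∈ S, D w v = 0 → 1 ≤ ∑ w ∈ S, kS w v → 22 ≤ cst D s U S a b v))) ∧
    (b v < 0 → (1 ≤ ∑ w ∈ U \ S, D v w → 3 ≤ cst D s U S a b v ∧
        (∑ w ∈ U \ S, s v w = 0 → 7 ≤ cst D s U S a b v)) ∧
      (2 ≤ ∑ w ∈ U \ S, D v w → 8 ≤ cst D s U S a b v) ∧
      (1 ≤ ∑ w ∈ U \ S, D v w → redA D s S f kD kS a v ≤ 0 → 7 ≤ cst D s U S a b v ∧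
        (1 ≤ ∑ w ∈ U \ S, s v w → 11 ≤ cst D s U S a b v)) ∧
      (∑ w ∈ U \ S, D v w = 0 → ∑ w ∈ U \ S, s v w = 0 → redA D s S f kD kS a v < 0 →
        14 ≤ cst D s U S a b v)) := by
  have hE := h.edge
  have hvU := (Finset.mem_sdiff.1 hv).1
  obtain ⟨N1, N2, H1, H2, Q1, Q2, Z, h1, h2, h3, h4, h5, h6, h7, hA, hB, hD, hs, -, hkD, hkS⟩ :=
    hk.atoms v
  have hDv := sum_split hSU hE.D_symm v
  have hsv := sum_split hSU hE.s_symm v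
  rw [hD] at hDv
  rw [hs] at hsv
  have hd : 0 ≤ ∑ w ∈ U \ S, D v w := Finset.sum_nonneg fun _ _ => hE.D_nonneg _ _
  have ht : 0 ≤ ∑ w ∈ U \ S, s v w := Finset.sum_nonneg fun _ _ => hE.s_nonneg _ _
  rw [hB] at hb
  rw [hA, hkD, hkS, hD]
  refine ⟨fun hbv => ?_, fun hbv => ?_⟩
  · have hdeg := h.degree_ge hvU
    rw [hDv, hsv] at hdeg
    exact cost_of_nonneg (h.a_le v) hbv h1 h2 h3 h4 h5 h6 h7 hd ht hdeg.1 hdeg.2 hb (h.b_le v)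
      (by rw [cst, hD, hs])
  · have hdeg := h.neg_degree hvU hbv
    rw [hDv, hsv] at hdeg
    have hav := h.not_zero_neg hvU hbv
    rw [hav]
    exact cost_of_neg hbv h1 h2 h3 h4 h5 h6 h7 ht hdeg (by rw [cst, hD, hs, hav])

/-- The case where only color `true` remains outside of a subset of least potential. -/
theorem Ctx.gap_of_neg (h : Ctx D s U a b) (hS : IsMin D s U a b S) {f : V → Bool}
    {l kD kS : V → V → ℤ} (hf : IsCol D s S a b f l) (hk : Allow D s S (U \ S) a b f l kD kS)
    (hneg : ∀ v ∈ U \ S, redB D s S f kD kS b v < 0) :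
    rho D s U a b + 14 ≤ rho D s S a b ∧ ((∀ v ∈ U, 0 ≤ b v) →
      ((1 ≤ ∑ v ∈ U \ S, ∑ w ∈ S, kD w v) ∨
        (∀ v ∈ U \ S, ∑ w ∈ S, D w v = 0) ∧ 1 ≤ ∑ v ∈ U \ S, ∑ w ∈ S, kS w v) →
      rho D s U a b + 22 ≤ rho D s S a b) := by
  have hE := h.edge
  have hSU := hS.ssubset.1
  have hr := rho_sub_eq (a := a) (b := b) hE hSU
  have hbd := fun v hv => h.cst_bounds hSU hk hv (hneg v hv)
  have hc := (h.crit_sdiff hS hf hk).1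
  have hD0 := hE.D_nonneg
  have hs0 := hE.s_nonneg
  have hUS := Finset.sdiff_subset (s := U) (t := S)
  rcases hc.structure_of_neg hE (fun v => (hk.red_le v).1.trans (h.a_le v)) hneg with
    ⟨v, hT, hv⟩ | ⟨v, u, hne, hT, hD, hav, hau⟩ |
    ⟨v, u, u', h1, h2, h3, hT, hD, hD', hav, hau, hau'⟩ <;>
  rw [hT] at hr hbd hUS ⊢
  · have hb := hbd v (Finset.mem_singleton_self v)
    simp only [Finset.sum_singleton, hE.D_self, hE.s_self, Finset.mem_singleton, forall_eq]
      at hr hb ⊢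
    rw [hr.symm] at hb
    refine ⟨?_, fun hall => ?_⟩
    · by_cases hbv : 0 ≤ b v
      · have := ((hb.1 hbv).2.2.2 hv).1
        omega
      · have := (hb.2 (not_le.1 hbv)).2.2.2 trivial trivial hv
        omega
    · obtain ⟨h1, h2, h3⟩ := (hb.1 (hall v (hUS (Finset.mem_singleton_self v)))).2.2.2 hv
      rintro (h4 | ⟨h4, h5⟩)
      · have := h2 h4
        omega
      · have := h3 h4 h5
        omega
  · have hb := hbd v (by simp)
    have hb' := hbd u (by simp)
    rw [Finset.sum_pair hne, Finset.sum_pair hne, hE.D_self, hE.s_self, hD] at hb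
    rw [Finset.sum_pair hne, Finset.sum_pair hne, hE.D_self, hE.s_self, hE.D_symm u v, hD,
      hE.s_symm u v] at hb'
    rw [Finset.sum_pair hne] at hr
    have h1 := hs0 v u
    refine ⟨?_, fun hall _ => ?_⟩
    · by_cases hbv : 0 ≤ b v
      · have h2 := (hb.1 hbv).2.2.1 (by norm_num) hav.le
        by_cases hbu : 0 ≤ b u
        · have h3 := (hb'.1 hbu).1 (by norm_num)
          omega
        · have h3 := ((hb'.2 (not_le.1 hbu)).1 (by norm_num)).1
          omega
      · have h2 := (hb.2 (not_le.1 hbv)).2.2.1 (by norm_num) hav.le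
        by_cases hbu : 0 ≤ b u
        · have h3 := (hb'.1 hbu).1 (by norm_num)
          omega
        · have h3 := (hb'.2 (not_le.1 hbu)).1 (by norm_num)
          by_cases h4 : s v u = 0
          · have := h3.2 (by omega)
            omega
          · have := h2.2 (by omega)
            omega
    · have h2 := (hb.1 (hall v (hUS (by simp)))).2.2.1 (by norm_num) hav.le
      have h3 := (hb'.1 (hall u (hUS (by simp)))).1 (by norm_num)
      omega
  · have hsum : ∀ g : V → ℤ, ∑ w ∈ ({v, u, u'} : Finset V), g w = g v + (g u + g u') := by
      intro g
      rw [Finset.sum_insert (by simp [h1, h2]), Finset.sum_pair h3]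
    have hb := hbd v (by simp)
    have hbu := hbd u (by simp)
    have hbu' := hbd u' (by simp)
    simp only [hsum] at hr hb hbu hbu'
    rw [hE.D_self, hD, hD'] at hb
    rw [hE.D_self, hE.D_symm u v, hD] at hbu
    rw [hE.D_self, hE.D_symm u' v, hD'] at hbu'
    have h4 := hD0 u u'
    have h5 := hD0 u' u
    have hu : 3 ≤ cst D s U S a b u ∧ (0 ≤ b u → 7 ≤ cst D s U S a b u) := by
      refine ⟨?_, fun h6 => (hbu.1 h6).1 (by omega)⟩
      by_cases h6 : 0 ≤ b u
      · have := (hbu.1 h6).1 (by omega)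
        omega
      · exact ((hbu.2 (not_le.1 h6)).1 (by omega)).1
    have hu' : 3 ≤ cst D s U S a b u' ∧ (0 ≤ b u' → 7 ≤ cst D s U S a b u') := by
      refine ⟨?_, fun h6 => (hbu'.1 h6).1 (by omega)⟩
      by_cases h6 : 0 ≤ b u'
      · have := (hbu'.1 h6).1 (by omega)
        omega
      · exact ((hbu'.2 (not_le.1 h6)).1 (by omega)).1
    refine ⟨?_, fun hall _ => ?_⟩
    · by_cases h6 : 0 ≤ b v
      · have := (hb.1 h6).2.1 (by norm_num)
        omega
      · have := (hb.2 (not_le.1 h6)).2.1 (by norm_num)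
        omega
    · have h6 := (hb.1 (hall v (hUS (by simp)))).2.1 (by norm_num)
      have h7 := hu.2 (hall u (hUS (by simp)))
      have h8 := hu'.2 (hall u' (hUS (by simp)))
      omega

theorem gn_edge {f : V → Bool} {c d : ℤ} {w v : V} (hD : 0 ≤ D w v - c) (hs : 0 ≤ s w v - d) :
    5 * c + 4 * d ≤ gn D s f (fun p q => if p = w ∧ q = v then c else 0)
      (fun p q => if p = w ∧ q = v then d else 0) w v := by
  simp only [gn, and_self, if_true]
  split_ifs <;> linarith

/-- Each edge has an allowance of one unit, at an ordinary edge if possible. -/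
theorem exists_unit (hE : EdgeData D s) {w v : V} (h : 1 ≤ D w v ∨ 0 < s w v) :
    ∃ c d : ℤ, 0 ≤ c ∧ 0 ≤ d ∧ c ≤ D w v ∧ d ≤ s w v ∧ c + d = 1 ∧ (1 ≤ D w v → c = 1) := by
  by_cases hD : 1 ≤ D w v
  · exact ⟨1, 0, by norm_num, le_rfl, hD, hE.s_nonneg _ _, by norm_num, fun _ => rfl⟩
  · have h1 := hE.D_nonneg w v
    exact ⟨0, 1, le_rfl, by norm_num, h1, by omega, by norm_num, fun h => absurd h hD⟩

theorem sum_single_le {k : ℤ} (hk : 0 ≤ k) (w : V) (T : Finset V) :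
    ∑ v ∈ T, (if v = w then k else 0) ≤ k := by
  rw [Finset.sum_ite_eq']
  split_ifs
  exacts [le_rfl, hk]

theorem Ctx.le_of_isMin (h : Ctx D s U a b) (hS : IsMin D s U a b S) {f : V → Bool}
    {l kD kS : V → V → ℤ} (hf : IsCol D s S a b f l) (hk : Allow D s S (U \ S) a b f l kD kS)
    {w v : V} (hw : w ∈ S) (hv : v ∈ U \ S) :
    (∀ v ∈ U \ S, redB D s S f kD kS b v < 0) ∨
      rho D s U a b + 12 + 2 * gn D s f kD kS w v ≤ rho D s S a b := by
  by_cases h1 : ∃ v ∈ U \ S, 0 ≤ redB D s S f kD kS b v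
  · have h2 := (h.crit_sdiff hS hf hk).2.1 h1
    have h3 := hk.gn_le_sum hw hv
    right
    linarith
  · push Not at h1
    exact Or.inl h1

theorem Ctx.col_slack (h : Ctx D s U a b) (hSU : S ⊂ U) {A B : V → ℤ} (hA : ∀ v, 0 ≤ A v)
    (hB : ∀ v, 0 ≤ B v) (hAb : ∀ v ∈ S, 0 ≤ b v ∨ A v = 0) {k : ℤ}
    (hk : ∑ v ∈ S, (4 * A v + 3 * B v) ≤ k)
    (hlt : ∀ T : Finset V, T.Nonempty → T ⊂ U → -12 + 2 * k < rho D s T a b) :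
    Col D s S (fun v => a v - A v) fun v => b v - B v := by
  by_contra hnc
  obtain ⟨S', hS', hne, hr⟩ := h.exists_le_of_not_col hSU hA hB hAb hnc
  have h1 := hlt S' hne (hS'.trans_ssubset hSU)
  have h2 := Finset.sum_le_sum_of_subset_of_nonneg (f := fun v => 4 * A v + 3 * B v) hS'
    fun v _ _ => by linarith [hA v, hB v]
  linarith

theorem Ctx.gap (h : Ctx D s U a b) (hS : S.Nonempty) (hSU : S ⊂ U) :
    rho D s U a b + 14 ≤ rho D s S a b := by
  have hE := h.edge
  obtain ⟨S₀, hS₀⟩ := h.exists_isMin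
  refine le_trans ?_ (hS₀.le S hS hSU)
  obtain ⟨f₀, l₀, hf₀⟩ := h.crit.2 S₀ hS₀.ssubset
  obtain ⟨w, hw, v, hv, hwv⟩ := h.exists_red hS₀ hf₀ (allow_zero hE _ hf₀)
  have hB0 : ∀ v, 0 ≤ if v = w then (1 : ℤ) else 0 := fun v => by split_ifs <;> norm_num
  obtain ⟨f, l, hf⟩ := h.col_slack hS₀.ssubset (A := fun _ => 0)
    (B := fun v => if v = w then 1 else 0) (k := 3) (fun _ => le_rfl) hB0
    (fun _ _ => Or.inr rfl) (by
      rw [Finset.sum_add_distrib, ← Finset.mul_sum, ← Finset.mul_sum, Finset.sum_ite_eq', if_pos hw]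
      simp) fun T h1 h2 => by
      have := h.weak_gap h1 h2
      have := h.lt
      omega
  have hf' := hf.of_slack (fun _ => le_rfl) hB0
  cases hfw : f w
  · obtain ⟨c, d, hc, hd, hcD, hds, hcd, -⟩ := exists_unit hE hwv
    have hk := allow_edge (W := U \ S₀) (w := w) (y := v) hE hf (fun _ => le_rfl) hB0 hc hd hcD hds
      (by simp [hfw, hcd])
    rcases h.le_of_isMin hS₀ hf' hk hw hv with h1 | h1
    · exact (h.gap_of_neg hS₀ hf' hk h1).1
    · have := gn_edge (f := f) (sub_nonneg.2 hcD) (sub_nonneg.2 hds)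
      omega
  · have hk := allow_zero hE (U \ S₀) hf'
    rcases h.le_of_isMin hS₀ hf' hk hw hv with h1 | h1
    · exact (h.gap_of_neg hS₀ hf' hk h1).1
    · have h2 := hE.D_nonneg w v
      have h3 := hE.s_nonneg w v
      simp only [gn, hfw, if_true] at h1
      omega

theorem Ctx.b_nonneg (h : Ctx D s U a b) {v : V} (hv : v ∈ U) : 0 ≤ b v := by
  by_contra! hbv
  have hE := h.edge
  have hlt := h.lt
  have hav := h.not_zero_neg hv hbv
  have hpot : pot (a v) (b v) = 5 := by
    simp [pot, hav, hbv.le]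
  have hdeg := h.neg_degree hv hbv
  obtain ⟨y₀, hy₀, c, d, hc, hd, hcD, hds, hcd, hc1⟩ : ∃ y ∈ U, ∃ c d : ℤ, 0 ≤ c ∧ 0 ≤ d ∧
      c ≤ D v y ∧ d ≤ s v y ∧ c + d = 1 ∧ (c = 1 ∨ ∀ w ∈ U, D v w = 0) := by
    by_cases hD : ∃ y ∈ U, 1 ≤ D v y
    · obtain ⟨y, hy, hvy⟩ := hD
      exact ⟨y, hy, 1, 0, by norm_num, le_rfl, hvy, hE.s_nonneg _ _, by norm_num, Or.inl rfl⟩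
    · push Not at hD
      have hD0 : ∀ w ∈ U, D v w = 0 := fun w hw => by
        have := hD w hw
        have := hE.D_nonneg v w
        omega
      obtain ⟨y, hy, hvy⟩ : ∃ y ∈ U, s v y ≠ 0 := by
        by_contra! hall
        rw [Finset.sum_eq_zero hD0, Finset.sum_eq_zero hall] at hdeg
        omega
      have := hE.s_nonneg v y
      exact ⟨y, hy, 0, 1, le_rfl, by norm_num, hE.D_nonneg _ _, by omega, by norm_num,
        Or.inr hD0⟩
  obtain ⟨T, hT, hne, hg, hT'⟩ := h.peel hv (by omega) hbv
    (allow_single hE (by omega) _ y₀ hc hd hcD hds (by omega))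
  have hTU := hT.trans (Finset.erase_subset v U)
  have hvT : v ∉ T := fun hh => (Finset.mem_erase.1 (hT hh)).1 rfl
  have hgap : insert v T ≠ U → 3 ≤ rho D s (insert v T) a b := fun hU => by
    have := h.gap (Finset.insert_nonempty v T) ((Finset.insert_subset hv hTU).ssubset_of_ne hU)
    omega
  rcases hT' with ⟨y, rfl, h1, h2⟩ | ⟨h1, h2⟩
  · have hy : y ∈ U := hTU (Finset.mem_singleton_self y)
    rw [rho_insert hE hvT, rho_singleton hE, hpot, Finset.sum_singleton, Finset.sum_singleton]
      at hgap
    have hrU : insert v {y} = U → rho D s U a b =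
        2 * pot (a y) (b y) + 2 * 5 - 18 * D v y - 8 * s v y := by
      intro hU
      rw [← hU, rho_insert hE hvT, rho_singleton hE, hpot, Finset.sum_singleton,
        Finset.sum_singleton]
    have h3 := h.a_le y
    have h4 := h.not_both_neg hy
    have h5 : b y < 0 → a y = 1 := h.not_zero_neg hy
    have h6 := hE.D_eq v y
    have h7 := hE.s_nonneg v y
    have h8 : pot (a y) (b y) = 1 + 4 * max (a y) (-1) + 3 * max (b y) 0 := if_neg h4
    by_cases hyy : y = y₀
    · subst hyy
      simp only [and_self, if_true] at h1 h2
      have h9 : c = 1 ∨ D v y = 0 := hc1.imp_right fun h => h y hy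
      have h10 : 2 * pot (a y) (b y) + 2 * 5 - 18 * D v y - 8 * s v y ≤ -12 := by
        rw [h8]
        clear hgap hrU hdeg hg
        by_cases hby : b y < 0
        · have := h5 hby
          omega
        · rcases h9 with h9 | h9 <;> omega
      by_cases hU : insert v {y} = U
      · have := hrU hU
        omega
      · have := hgap hU
        omega
    · have hU : insert v {y} ≠ U := by
        rintro rfl
        rw [Finset.mem_insert, Finset.mem_singleton] at hy₀
        obtain rfl := hy₀.resolve_right (Ne.symm hyy)
        rw [hE.D_self] at hcD
        rw [hE.s_self] at hds
        omega
      have h9 := hgap hU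
      rw [h8] at h9
      simp only [hyy, and_false, if_false] at h1 h2
      clear hgap hrU hdeg hg hpot
      by_cases hby : b y < 0
      · have := h5 hby
        omega
      · rcases h6 with h6 | h6 <;> omega
  · rw [hpot] at h1 h2
    by_cases hU : insert v T = U
    · have h3 := h2 hU
      have hTe : T = U.erase v := by rw [← hU, Finset.erase_insert hvT]
      have hy₀T : y₀ ∈ T := by
        rw [hTe, Finset.mem_erase]
        refine ⟨?_, hy₀⟩
        rintro rfl
        rw [hE.D_self] at hcD
        rw [hE.s_self] at hds
        omega
      have h4 : ∀ y ∈ T, gn D s (fun _ => true) (fun p q => if p = v ∧ q = y₀ then c else 0)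
          (fun p q => if p = v ∧ q = y₀ then d else 0) v y =
          (D v y + s v y) + if y = y₀ then 4 * c + 3 * d else 0 := by
        intro y _
        simp only [gn, if_true, true_and]
        split_ifs <;> ring
      rw [Finset.sum_congr rfl h4, Finset.sum_add_distrib, Finset.sum_ite_eq', if_pos hy₀T,
        Finset.sum_add_distrib, hTe, sum_erase_D hE, sum_erase_s hE] at h3
      have h5 : 0 ≤ ∑ w ∈ U, D v w := Finset.sum_nonneg fun _ _ => hE.D_nonneg _ _
      have h6 : 0 ≤ ∑ w ∈ U, s v w := Finset.sum_nonneg fun _ _ => hE.s_nonneg _ _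
      rcases hc1 with hc1 | hc1
      · omega
      · rw [Finset.sum_eq_zero hc1] at hdeg h3
        omega
    · have := hgap hU
      omega

theorem sum_sum_ite {w v : V} (hw : w ∈ S) (hv : v ∈ T) (c : ℤ) :
    ∑ q ∈ T, ∑ p ∈ S, (if p = w ∧ q = v then c else 0) = c := by
  rw [Finset.sum_eq_single v, Finset.sum_eq_single w] <;> simp +contextual [hw, hv]

theorem Ctx.gap_of_isMin (h : Ctx D s U a b) (hS : IsMin D s U a b S) :
    rho D s U a b + 20 ≤ rho D s S a b ∧
      ((∃ w ∈ S, ∃ v ∈ U \ S, 1 ≤ D w v) → rho D s U a b + 22 ≤ rho D s S a b) := by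
  have hE := h.edge
  obtain ⟨w, hw, v, hv, hwv, hdir⟩ : ∃ w ∈ S, ∃ v ∈ U \ S, (1 ≤ D w v ∨ 0 < s w v) ∧
      ((∃ w ∈ S, ∃ v ∈ U \ S, 1 ≤ D w v) → 1 ≤ D w v) := by
    by_cases hD : ∃ w ∈ S, ∃ v ∈ U \ S, 1 ≤ D w v
    · obtain ⟨w, hw, v, hv, hwv⟩ := hD
      exact ⟨w, hw, v, hv, Or.inl hwv, fun _ => hwv⟩
    · obtain ⟨f₀, l₀, hf₀⟩ := h.crit.2 S hS.ssubset
      obtain ⟨w, hw, v, hv, hwv⟩ := h.exists_red hS hf₀ (allow_zero hE _ hf₀)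
      exact ⟨w, hw, v, hv, hwv, fun h => absurd h hD⟩
  have hB0 : ∀ v, 0 ≤ if v = w then (1 : ℤ) else 0 := fun v => by split_ifs <;> norm_num
  obtain ⟨f, l, hf⟩ := h.col_slack hS.ssubset (A := fun v => if v = w then 1 else 0)
    (B := fun v => if v = w then 1 else 0) (k := 7) hB0 hB0
    (fun u hu => Or.inl (h.b_nonneg (hS.ssubset.1 hu))) (by
      rw [Finset.sum_add_distrib, ← Finset.mul_sum, ← Finset.mul_sum, Finset.sum_ite_eq', if_pos hw]
      norm_num) fun T h1 h2 => by
      have := h.gap h1 h2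
      have := h.lt
      omega
  have hf' := hf.of_slack hB0 hB0
  obtain ⟨c, d, hc, hd, hcD, hds, hcd, hc1⟩ := exists_unit hE hwv
  have hk := allow_edge (W := U \ S) (w := w) (y := v) hE hf hB0 hB0 hc hd hcD hds
    (by simp [hcd])
  rcases h.le_of_isMin hS hf' hk hw hv with h1 | h1
  · have h2 := (h.gap_of_neg hS hf' hk h1).2 (fun v hv => h.b_nonneg hv)
    rw [sum_sum_ite hw hv, sum_sum_ite hw hv] at h2
    have h3 : rho D s U a b + 22 ≤ rho D s S a b := by
      refine h2 ?_
      by_cases hD : 1 ≤ D w v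
      · exact Or.inl (hc1 hD).ge
      · refine Or.inr ⟨fun y hy => Finset.sum_eq_zero fun x hx => ?_, by omega⟩
        have h4 := hE.D_nonneg x y
        have h5 : ¬ 1 ≤ D x y := fun h => hD (hdir ⟨x, hx, y, hy, h⟩)
        omega
    exact ⟨by linarith, fun _ => h3⟩
  · have h2 := gn_edge (f := f) (sub_nonneg.2 hcD) (sub_nonneg.2 hds)
    exact ⟨by omega, fun h => by have := hc1 (hdir h); omega⟩

theorem Ctx.strong_gap (h : Ctx D s U a b) (hS : S.Nonempty) (hSU : S ⊂ U) :
    rho D s U a b + 22 ≤ rho D s S a b := by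
  have hE := h.edge
  obtain ⟨R, hR⟩ := h.exists_isMin
  refine le_trans ?_ (hR.le S hS hSU)
  by_cases hD : ∃ w ∈ R, ∃ v ∈ U \ R, 1 ≤ D w v
  · exact (h.gap_of_isMin hR).2 hD
  have hD0 : ∀ w ∈ R, ∀ v ∈ U \ R, D w v = 0 := fun w hw v hv => by
    have h1 := hE.D_nonneg w v
    have h2 : ¬ 1 ≤ D w v := fun h => hD ⟨w, hw, v, hv, h⟩
    omega
  have hlt : ∀ T : Finset V, T.Nonempty → T ⊂ U → 8 < rho D s T a b := fun T h1 h2 => by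
    have := (h.gap_of_isMin hR).1
    have := hR.le T h1 h2
    have := h.lt
    omega
  have hone : ∀ w v : V, 0 ≤ if v = w then (1 : ℤ) else 0 := fun w v => by
    split_ifs <;> norm_num
  have hsum : ∀ w ∈ R, ∑ v ∈ R, (if v = w then (1 : ℤ) else 0) = 1 := fun w hw => by
    rw [Finset.sum_ite_eq', if_pos hw]
  obtain ⟨f₀, l₀, hf₀⟩ := h.crit.2 R hR.ssubset
  obtain ⟨w, hw, v, hv, hwv⟩ := h.exists_red hR hf₀ (allow_zero hE _ hf₀)
  have hwv' : 1 ≤ s w v := by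
    have := hD0 w hw v hv
    omega
  obtain ⟨f₁, l₁, hf₁⟩ := h.col_slack hR.ssubset (A := fun v => if v = w then 1 else 0)
    (B := fun v => if v = w then 1 else 0) (k := 7) (hone w) (hone w)
    (fun u hu => Or.inl (h.b_nonneg (hR.ssubset.1 hu))) (by
      rw [Finset.sum_add_distrib, ← Finset.mul_sum, ← Finset.mul_sum, hsum w hw]
      norm_num) fun T h1 h2 => by
      have := hlt T h1 h2
      omega
  obtain ⟨w', hw', v', hv', hwv₁⟩ := h.exists_red hR (hf₁.of_slack (hone w) (hone w))
    (allow_edge (W := U \ R) (w := w) (y := v) hE hf₁ (hone w) (hone w) le_rfl zero_le_one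
      (hE.D_nonneg _ _) hwv' (by simp))
  have hX : (if w' = w ∧ v' = v then (1 : ℤ) else 0) < s w' v' := by
    have := hD0 w' hw' v' hv'
    omega
  have hB : ∀ u, 0 ≤ (if u = w then (1 : ℤ) else 0) + if u = w' then 1 else 0 :=
    fun u => add_nonneg (hone w u) (hone w' u)
  obtain ⟨f, l, hf⟩ := h.col_slack hR.ssubset (A := fun u => if u = w then 1 else 0)
    (B := fun u => (if u = w then 1 else 0) + if u = w' then 1 else 0) (k := 10) (hone w) hB
    (fun u hu => Or.inl (h.b_nonneg (hR.ssubset.1 hu))) (by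
      rw [Finset.sum_add_distrib, ← Finset.mul_sum, ← Finset.mul_sum, Finset.sum_add_distrib,
        hsum w hw, hsum w' hw']
      norm_num) fun T h1 h2 => by
      have := hlt T h1 h2
      omega
  have hf' := hf.of_slack (hone w) hB
  obtain ⟨kS, hkS⟩ : ∃ kS : V → V → ℤ, ∀ p q, kS p q = (if p = w ∧ q = v then 1 else 0) +
      if f w' = false then if p = w' ∧ q = v' then 1 else 0 else 0 := ⟨_, fun _ _ => rfl⟩
  have hk : Allow D s R (U \ R) a b f l (fun _ _ => 0) kS := by
    refine allow_of_slack hf (fun _ _ => le_rfl) (fun p q => ?_) hE.D_nonneg (fun p q => ?_)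
      fun p hp => ?_
    · rw [hkS]
      split_ifs <;> norm_num
    · have h1 := hE.s_nonneg p q
      rw [hkS]
      by_cases h2 : p = w' ∧ q = v'
      · obtain ⟨rfl, rfl⟩ := h2
        split_ifs at hX ⊢ <;> simp_all <;> omega
      · by_cases h3 : p = w ∧ q = v
        · obtain ⟨rfl, rfl⟩ := h3
          simp [h2, hwv']
        · simp [h2, h3, h1]
    · have h1 : ∀ (x y : V), ∑ q ∈ U \ R, (if p = x ∧ q = y then (1 : ℤ) else 0) ≤
          if p = x then 1 else 0 := by
        intro x y
        by_cases hpx : p = x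
        · simpa only [hpx, true_and, if_true] using sum_single_le zero_le_one y (U \ R)
        · simp [hpx]
      have h2 := h1 w v
      have h3 := h1 w' v'
      simp only [hkS, zero_add, Finset.sum_add_distrib]
      cases hfw : f w'
      · simp only [if_true]
        by_cases hpw : p = w'
        · have h4 : f p = false := hpw ▸ hfw
          simp only [h4, Bool.false_eq_true, if_false]
          exact add_le_add h2 h3
        · rw [if_neg hpw] at h3 ⊢
          rw [add_zero]
          split_ifs at h2 ⊢ <;> linarith
      · simp only [Bool.true_eq_false, if_false, Finset.sum_const_zero, add_zero]
        have := hone w' p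
        split_ifs at h2 this ⊢ <;> linarith
  have hgn : ∀ q ∈ U \ R, ∀ p ∈ R, 4 * (if p = w ∧ q = v then 1 else 0) +
      (if p = w' ∧ q = v' then 1 else 0) ≤ gn D s f (fun _ _ => 0) kS p q := by
    intro q hq p hp
    have h1 := hk.kS_le p q
    have h2 := hk.kS_nonneg p q
    rw [gn, hD0 p hp q hq]
    rw [hkS] at h1 h2 ⊢
    by_cases h3 : p = w' ∧ q = v'
    · obtain ⟨rfl, rfl⟩ := h3
      cases hfp : f p
      · simp only [and_self, if_true]
        split_ifs <;> simp_all
      · simp only [and_self, if_true]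
        split_ifs at hX ⊢ <;> simp_all <;> omega
    · split_ifs at h1 ⊢ <;> simp_all
  have hsg := Finset.sum_le_sum fun q hq => Finset.sum_le_sum (hgn q hq)
  have hsk : ∑ q ∈ U \ R, ∑ p ∈ R, (if p = w ∧ q = v then (1 : ℤ) else 0) ≤
      ∑ q ∈ U \ R, ∑ p ∈ R, kS p q := by
    refine Finset.sum_le_sum fun q _ => Finset.sum_le_sum fun p _ => ?_
    rw [hkS]
    refine le_add_of_nonneg_right ?_
    split_ifs <;> norm_num
  rw [sum_sum_ite hw hv] at hsk
  simp only [Finset.sum_add_distrib, ← Finset.mul_sum] at hsg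
  rw [sum_sum_ite hw hv, sum_sum_ite hw' hv'] at hsg
  by_cases h1 : ∃ v ∈ U \ R, 0 ≤ redB D s R f (fun _ _ => 0) kS b v
  · have := (h.crit_sdiff hR hf' hk).2.1 h1
    linarith
  · push Not at h1
    exact (h.gap_of_neg hR hf' hk h1).2 (fun v hv => h.b_nonneg hv) (Or.inr
      ⟨fun v hv => Finset.sum_eq_zero fun w hw => hD0 w hw v hv, hsk⟩)

theorem sum_ite_nonneg {f : V → Bool} {g : V → ℤ} (hg : ∀ v, 0 ≤ g v) :
    0 ≤ ∑ v ∈ T, (if f v then g v else 0) :=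
  Finset.sum_nonneg fun v _ => by
    have := hg v
    split_ifs <;> linarith

theorem sum_ite_nonneg' {f : V → Bool} {g : V → ℤ} (hg : ∀ v, 0 ≤ g v) :
    0 ≤ ∑ v ∈ T, (if f v then 0 else g v) :=
  Finset.sum_nonneg fun v _ => by
    have := hg v
    split_ifs <;> linarith

theorem sum_ite_add (f : V → Bool) (g : V → ℤ) :
    ∑ v ∈ T, (if f v then g v else 0) + ∑ v ∈ T, (if f v then 0 else g v) = ∑ v ∈ T, g v := by
  rw [← Finset.sum_add_distrib]
  exact Finset.sum_congr rfl fun v _ => by split_ifs <;> ring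

/-- Removing `x` while reserving `kA` units of color `true` and `kB` units of color `false` at the
ends of soft edges of `x`. -/
theorem Ctx.reduce (h : Ctx D s U a b) {x : V} (hx : x ∈ U) {kA kB : ℤ} (hB0 : 0 ≤ kB)
    (hBA : kB ≤ kA) (hAs : kA ≤ ∑ w ∈ U, s x w) (hB1 : kB ≤ 1) (hK : 4 * kA + 3 * kB ≤ 11)
    (hcnt : ∀ p q r t : ℤ, 0 ≤ p → 0 ≤ r → kA - r ≤ q → 0 ≤ q → 0 ≤ t → t ≤ kB → kB - t ≤ r →
      a x < 5 * p + q - t → b x < ∑ w ∈ U, D x w + ∑ w ∈ U, s x w - p - q - r → False)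
    (hU : 1 ≤ ∑ w ∈ U, D x w → pot (a x) (b x) + 4 * kA + 3 * kB ≤
      6 * ∑ w ∈ U, D x w + 4 * ∑ w ∈ U, s x w) : False := by
  have hE := h.edge
  have hlt := h.lt
  obtain ⟨A, hA, hAs', hAk⟩ := exists_sum_eq (hE.s_nonneg x) (U.erase x) (hB0.trans hBA)
    (by rwa [sum_erase_s hE])
  obtain ⟨B, hB, hBA', hBk⟩ := exists_sum_eq hA (U.erase x) hB0 (by rwa [hAk])
  obtain ⟨S', hS', hne, hr⟩ := h.removal hx hA hB hAs' (fun v => (hBA' v).trans (hAs' v))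
    (fun v hv => Or.inl (h.b_nonneg (Finset.mem_of_mem_erase hv))) (by
      intro f h1 h2
      have hs := sum_ite_add (T := U.erase x) f (s x)
      have hD := sum_ite_add (T := U.erase x) f (D x)
      have hfA := sum_ite_add (T := U.erase x) f A
      have hfB := sum_ite_add (T := U.erase x) f B
      rw [sum_erase_s hE] at hs
      rw [sum_erase_D hE] at hD
      have hle1 : ∑ v ∈ U.erase x, (if f v then 0 else A v) ≤
          ∑ v ∈ U.erase x, (if f v then 0 else s x v) :=
        Finset.sum_le_sum fun v _ => by
          split_ifs
          exacts [le_rfl, hAs' v]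
      have hle2 : ∑ v ∈ U.erase x, (if f v then B v else 0) ≤
          ∑ v ∈ U.erase x, (if f v then A v else 0) :=
        Finset.sum_le_sum fun v _ => by
          split_ifs
          exacts [hBA' v, le_rfl]
      have e1 : ∑ w ∈ U.erase x, (if f w then 5 * D x w else s x w - B w) =
          5 * ∑ v ∈ U.erase x, (if f v then D x v else 0) +
            ∑ v ∈ U.erase x, (if f v then 0 else s x v) -
            ∑ v ∈ U.erase x, (if f v then 0 else B v) := by
        rw [Finset.mul_sum, ← Finset.sum_add_distrib, ← Finset.sum_sub_distrib]
        exact Finset.sum_congr rfl fun v _ => by split_ifs <;> ring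
      have e2 : ∑ w ∈ U.erase x, (if f w then s x w - A w else D x w) =
          ∑ v ∈ U.erase x, (if f v then s x v else 0) +
            ∑ v ∈ U.erase x, (if f v then 0 else D x v) -
            ∑ v ∈ U.erase x, (if f v then A v else 0) := by
        rw [← Finset.sum_add_distrib, ← Finset.sum_sub_distrib]
        exact Finset.sum_congr rfl fun v _ => by split_ifs <;> ring
      have n1 := sum_ite_nonneg (T := U.erase x) (f := f) hB
      refine hcnt _ _ _ _ (sum_ite_nonneg (f := f) (hE.D_nonneg x)) (sum_ite_nonneg (f := f) hA)
        (by linarith) (sum_ite_nonneg' (f := f) (hE.s_nonneg x)) (sum_ite_nonneg' (f := f) hB)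
        (by linarith) (by linarith) (e1 ▸ h1) ?_
      rw [e2] at h2
      linarith)
  have hxS : x ∉ S' := fun hh => (Finset.mem_erase.1 (hS' hh)).1 rfl
  have hSU : S' ⊂ U := hS'.trans_ssubset (Finset.erase_ssubset hx)
  have h1 := h.strong_gap hne hSU
  have h2 := rho_insert (a := a) (b := b) hE hxS
  have h3 : ∑ v ∈ S', (4 * A v + 3 * (D x v + B v)) =
      4 * ∑ v ∈ S', A v + 3 * ∑ v ∈ S', D x v + 3 * ∑ v ∈ S', B v := by
    simp only [Finset.sum_add_distrib, ← Finset.mul_sum]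
    ring
  have hAle : ∑ v ∈ S', A v ≤ kA :=
    hAk ▸ Finset.sum_le_sum_of_subset_of_nonneg hS' fun v _ _ => hA v
  have hBle : ∑ v ∈ S', B v ≤ kB :=
    hBk ▸ Finset.sum_le_sum_of_subset_of_nonneg hS' fun v _ _ => hB v
  have hAsle : ∑ v ∈ S', A v ≤ ∑ v ∈ S', s x v := Finset.sum_le_sum fun v _ => hAs' v
  have hpot : pot (a x) (b x) ≤ 14 := by
    have := h.a_le x
    have := h.b_le x
    simp only [pot, max_def]
    split_ifs <;> omega
  have hD0 : 0 ≤ ∑ v ∈ S', D x v := Finset.sum_nonneg fun _ _ => hE.D_nonneg _ _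
  rw [h3] at hr
  by_cases hj : ∑ v ∈ S', D x v = 0
  · omega
  by_cases hU' : insert x S' = U
  · have hSe : S' = U.erase x := by rw [← hU', Finset.erase_insert hxS]
    rw [hU', hSe, sum_erase_D hE, sum_erase_s hE] at h2
    rw [hSe, sum_erase_D hE] at hj hr hD0
    rw [hSe] at hAle hBle
    have := hU (by omega)
    omega
  · have := h.strong_gap (Finset.insert_nonempty x S')
      ((Finset.insert_subset hx hSU.1).ssubset_of_ne hU')
    omega

/-- The charge of a vertex, where each edge is split evenly between its ends. -/
def charge (D s : V → V → ℤ) (U : Finset V) (a b : V → ℤ) (v : V) : ℤ :=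
  2 * pot (a v) (b v) - 9 * ∑ w ∈ U, D v w - 4 * ∑ w ∈ U, s v w

theorem rho_eq_sum_charge : rho D s U a b = ∑ v ∈ U, charge D s U a b v := by
  simp only [rho, charge, Finset.sum_sub_distrib, Finset.mul_sum, Finset.sum_add_distrib]
  ring

theorem Ctx.charge_le (h : Ctx D s U a b) {x : V} (hx : x ∈ U) :
    charge D s U a b x ≤ 0 ∧ (1 ≤ ∑ w ∈ U, D x w → charge D s U a b x ≤ -5) ∧
      (a x = 0 → 1 ≤ ∑ w ∈ U, D x w → charge D s U a b x ≤ -7) ∧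
      (a x < 0 → charge D s U a b x ≤ -12) := by
  have hE := h.edge
  have hlt := h.lt
  have hdeg := h.degree_ge hx
  have hb0 := h.b_nonneg hx
  have hb3 := h.b_le x
  have ha1 := h.a_le x
  have hj0 : 0 ≤ ∑ w ∈ U, D x w := Finset.sum_nonneg fun _ _ => hE.D_nonneg _ _
  have hs0 : 0 ≤ ∑ w ∈ U, s x w := Finset.sum_nonneg fun _ _ => hE.s_nonneg _ _
  have hred := @Ctx.reduce _ _ _ _ _ _ _ h x hx
  have hsing := h.strong_gap (Finset.singleton_nonempty x) (h.ssubset_singleton hx)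
  rw [rho_singleton hE] at hsing
  have hpot : pot (a x) (b x) = 1 + 4 * max (a x) (-1) + 3 * b x := by
    rw [pot, if_neg (by omega), max_eq_left hb0]
  unfold charge
  rw [hpot] at hred hsing ⊢
  generalize ∑ w ∈ U, D x w = j at *
  generalize ∑ w ∈ U, s x w = σ at *
  rcases lt_trichotomy (a x) 0 with ha | ha | ha
  · have h1 := @hred 2 0 le_rfl (by norm_num)
    have h2 : ¬ (j + σ ≤ b x + 2 ∧ 2 ≤ σ) := fun h3 =>
      h1 h3.2 (by norm_num) (by norm_num) (fun p q r t => by omega) (by omega)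
    clear h1 hred
    omega
  · have h1 := @hred 1 1 (by norm_num) le_rfl
    have h2 : ¬ (j + σ ≤ b x + 2 ∧ 1 ≤ σ) := fun h3 =>
      h1 h3.2 (by norm_num) (by norm_num) (fun p q r t => by omega) (by omega)
    clear h1 hred
    omega
  · have h1 := @hred 1 0 le_rfl (by norm_num)
    have h2 : ¬ (j + σ ≤ b x + 2 ∧ 1 ≤ σ) := fun h3 =>
      h1 h3.2 (by norm_num) (by norm_num) (fun p q r t => by omega) (by omega)
    have h4 := @hred 2 1 (by norm_num) (by norm_num)
    have h5 : ¬ (j + σ ≤ b x + 3 ∧ 2 ≤ b x ∧ 2 ≤ σ) := fun h3 =>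
      h4 h3.2.2 (by norm_num) (by norm_num) (fun p q r t => by omega) (by omega)
    clear h1 h4 hred
    omega

theorem EdgeData.one_le_sum (hE : EdgeData D s) {u v : V} (hu : u ∈ U) (h : D u v = 1) :
    1 ≤ ∑ w ∈ U, D v w := by
  rw [← h, hE.D_symm]
  exact Finset.single_le_sum (f := fun w => D v w) (fun w _ => hE.D_nonneg v w) hu

theorem Ctx.rho_le_sum_charge (h : Ctx D s U a b) (hT : T ⊆ U) :
    rho D s U a b ≤ ∑ v ∈ T, charge D s U a b v := by
  rw [rho_eq_sum_charge, ← Finset.sum_sdiff hT]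
  have := Finset.sum_nonpos fun v (hv : v ∈ U \ T) => (h.charge_le (Finset.sdiff_subset hv)).1
  linarith

theorem Ctx.false (h : Ctx D s U a b) : False := by
  have hE := h.edge
  have hlt := h.lt
  obtain ⟨v, hv, hd⟩ : ∃ v ∈ U, a v < ∑ w ∈ U, D v w := by
    by_contra! hall
    exact h.crit.1 (col_true hall)
  have hcv := h.charge_le hv
  have h1 := h.rho_le_sum_charge (Finset.singleton_subset_iff.2 hv)
  rw [Finset.sum_singleton] at h1
  have ha0 : 0 ≤ a v := by
    by_contra! ha
    have := hcv.2.2.2 ha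
    omega
  obtain ⟨u, hu, hvu⟩ : ∃ u ∈ U, D v u = 1 := by
    by_contra! hall
    rw [Finset.sum_eq_zero fun w hw => (hE.D_eq v w).resolve_right (hall w hw)] at hd
    omega
  have hne : v ≠ u := by
    rintro rfl
    rw [hE.D_self] at hvu
    omega
  have hcu := (h.charge_le hu).2.1 (hE.one_le_sum hv hvu)
  by_cases hav : a v = 0
  · have h2 := h.rho_le_sum_charge (T := {v, u}) (by simp [Finset.insert_subset_iff, hv, hu])
    rw [Finset.sum_pair hne] at h2
    have := hcv.2.2.1 hav (by omega)
    omega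
  · obtain ⟨u', hu', huu, hvu'⟩ : ∃ u' ∈ U, u ≠ u' ∧ D v u' = 1 := by
      by_contra! hall
      rw [Finset.sum_eq_single u (fun w hw hwu => (hE.D_eq v w).resolve_right (hall w hw hwu.symm))
        (fun h => absurd hu h), hvu] at hd
      omega
    have hne' : v ≠ u' := by
      rintro rfl
      rw [hE.D_self] at hvu'
      omega
    have hcu' := (h.charge_le hu').2.1 (hE.one_le_sum hv hvu')
    have h2 := h.rho_le_sum_charge (T := {v, u, u'})
      (by simp [Finset.insert_subset_iff, hv, hu, hu'])
    rw [Finset.sum_insert (by simp [hne, hne']), Finset.sum_pair huu] at h2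
    have := hcv.2.1 (by omega)
    omega

theorem Crit.bound (hE : EdgeData D s) (ha : ∀ v, a v ≤ 1) (hb : ∀ v, b v ≤ 3)
    (h : Crit D s U a b) : Bound D s U a b := by
  induction hn : U.card using Nat.strong_induction_on generalizing D s U a b with
  | _ n ih =>
    by_cases hB : ∀ v ∈ U, b v < 0
    · exact h.bound_of_neg hE ha hB
    push Not at hB
    suffices rho D s U a b ≤ -12 from ⟨by omega, fun _ => this⟩
    by_contra! hlt
    exact Ctx.false ⟨hE, ha, hb, h,
      fun D' s' T a' b' hT hE' ha' hb' hc => ih _ (hn ▸ hT) hE' ha' hb' hc rfl, hB, hlt⟩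

/-- Ordinary edges of a simple graph. -/
noncomputable def adjCount (G : SimpleGraph V) (u v : V) : ℤ :=
  open Classical in if G.Adj u v then 1 else 0

theorem edgeData_adjCount (G : SimpleGraph V) : EdgeData (adjCount G) fun _ _ => 0 where
  D_symm u v := by
    unfold adjCount
    have := G.adj_comm u v
    split_ifs <;> tauto
  s_symm _ _ := rfl
  D_self v := by simp [adjCount]
  s_self _ := rfl
  D_nonneg u v := by
    unfold adjCount
    split_ifs <;> simp
  D_le u v := by
    unfold adjCount
    split_ifs <;> simp
  s_nonneg _ _ := le_rfl

theorem sum_adjCount (G : SimpleGraph V) (f : V → Bool) (v : V) (T : Finset V) :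
    ∑ w ∈ T, (if f w = f v then adjCount G v w else 0) =
      ((G.neighborSet v ∩ {u | f u = f v} ∩ T).ncard : ℤ) := by
  classical
  have : G.neighborSet v ∩ {u | f u = f v} ∩ T =
      ((T.filter fun w => f w = f v ∧ G.Adj v w : Finset V) : Set V) := by
    ext w
    simp
    tauto
  rw [this, Set.ncard_coe_finset, Finset.card_filter]
  push_cast
  refine Finset.sum_congr rfl fun w _ => ?_
  simp only [adjCount]
  split_ifs <;> simp_all

theorem rho_adjCount [Fintype V] (G : SimpleGraph V) :
    rho (adjCount G) (fun _ _ => 0) Finset.univ (fun _ => 1) (fun _ => 3) =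
      28 * Fintype.card V - 18 * G.edgeSet.ncard := by
  classical
  have h1 : ∑ u : V, ∑ v : V, adjCount G u v = 2 * (G.edgeSet.ncard : ℤ) := by
    rw [← G.coe_edgeFinset, Set.ncard_coe_finset]
    have := G.sum_degrees_eq_twice_card_edges
    rw [← Nat.cast_ofNat, ← Nat.cast_mul, ← this, Nat.cast_sum]
    refine Finset.sum_congr rfl fun u _ => ?_
    simp [adjCount, ← G.card_neighborFinset_eq_degree, SimpleGraph.neighborFinset_eq_filter]
  simp only [rho, pot, mul_zero, add_zero, ← Finset.mul_sum, h1]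
  simp
  ring

theorem crit_adjCount [Fintype V] {G : SimpleGraph V} (h : Critical13 G) :
    Crit (adjCount G) (fun _ _ => 0) Finset.univ (fun _ => 1) (fun _ => 3) := by
  constructor
  · rintro ⟨f, l, hl, -, hf⟩
    have key : ∀ v, ((G.neighborSet v ∩ {u | f u = f v}).ncard : ℤ) ≤ if f v then 1 else 3 := by
      intro v
      have h1 := sum_adjCount G f v Finset.univ
      rw [Finset.coe_univ, Set.inter_univ] at h1
      rw [← h1]
      refine le_trans (Finset.sum_le_sum fun w _ => ?_) (hf v (Finset.mem_univ v))
      split_ifs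
      exacts [le_rfl, hl _ _]
    refine h.1 ⟨f, fun v hv => ?_, fun v hv => ?_⟩
    all_goals
      have := key v
      simp only [hv] at this
      exact_mod_cast this
  · intro T hT
    obtain ⟨g, hg1, hg2⟩ := h.2 ((⊤ : G.Subgraph).induce T) fun he => hT.ne (by
      have := congrArg SimpleGraph.Subgraph.verts he
      simpa using this)
    let f : V → Bool := fun v => if hv : v ∈ T then g ⟨v, hv⟩ else true
    have hfg : ∀ v (hv : v ∈ T), f v = g ⟨v, hv⟩ := fun v hv => dif_pos hv
    refine ⟨f, fun _ _ => 0, fun _ _ => le_rfl, fun _ _ _ _ _ => by simp, fun v hv => ?_⟩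
    rw [sum_adjCount]
    have key : (G.neighborSet v ∩ {u | f u = f v} ∩ T).ncard =
        (((⊤ : G.Subgraph).induce T).coe.neighborSet ⟨v, hv⟩ ∩
          {u | g u = g ⟨v, hv⟩}).ncard := by
      rw [← Set.ncard_image_of_injective _ Subtype.val_injective]
      congr 1
      ext w
      constructor
      · rintro ⟨⟨h1, h2⟩, h3⟩
        refine ⟨⟨w, h3⟩, ⟨⟨hv, h3, h1⟩, ?_⟩, rfl⟩
        rw [Set.mem_ofPred_eq, ← hfg w h3, ← hfg v hv]
        exact h2
      · rintro ⟨⟨w, h3⟩, ⟨⟨-, -, h1⟩, h2⟩, rfl⟩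
        refine ⟨⟨h1, ?_⟩, h3⟩
        rw [Set.mem_ofPred_eq, hfg w h3, hfg v hv]
        exact h2
    rw [key, hfg v hv]
    cases hgv : g ⟨v, hv⟩
    · simpa using hg2 _ hgv
    · simpa using hg1 _ hgv

end DefectiveColoring

/-- If G is (1,3)-critical, then 14|V(G)| - 9|E(G)| ≤ -6. -/
theorem stmt4 {V : Type*} [Fintype V] (G : SimpleGraph V) (h : Critical13 G) :
    (14 : ℤ) * Fintype.card V - 9 * G.edgeSet.ncard ≤ -6 := by
  classical
  have hc := DefectiveColoring.crit_adjCount h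
  obtain ⟨v, hv⟩ := hc.nonempty
  have hb := (hc.bound (DefectiveColoring.edgeData_adjCount G) (fun _ => le_rfl)
    fun _ => le_rfl).2 ⟨v, hv, by norm_num⟩
  rw [DefectiveColoring.rho_adjCount] at hb
  omega
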